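/- arXiv:1811.08689 — 3 statements merged into one kernel-verified Lean document; each statement's English description precedes it below -/
import Mathlib

section
/- Let S be a Cu-semigroup. Then the evaluation pairing ⟦S,S⟧ × S → S, (x,a) ↦ x(a) := σ_{S,S}(x)(a), is a Cu-bimorphism and defines a left action of the Cu-semiring ⟦S,S⟧ on S: for all x, y ∈ ⟦S,S⟧ and a ∈ S one has (y∘x)(a) = y(x(a)) and ⟨id_S⟩(a) = a. -/
/-! ### Abstract Cuntz semigroups: basic framework -/

/-- The way-below (compact containment) relation. -/
def WayBelow {S : Type*} [Preorder S] (a b : S) : Prop :=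
  ∀ c : ℕ → S, Monotone c → ∀ s : S, IsLUB (Set.range c) s → b ≤ s → ∃ n, a ≤ c n

/-- A `Cu`-semigroup (abstract Cuntz semigroup): a positively ordered monoid
satisfying the axioms (O1)-(O4). -/
class CuSemigroup (S : Type*) [AddCommMonoid S] [PartialOrder S] : Prop where
  add_le_add' : ∀ a b c d : S, a ≤ b → c ≤ d → a + c ≤ b + d
  zero_le' : ∀ a : S, (0 : S) ≤ a
  O1 : ∀ c : ℕ → S, Monotone c → ∃ s : S, IsLUB (Set.range c) s
  O2 : ∀ a : S, ∃ c : ℕ → S, (∀ n, WayBelow (c n) (c (n + 1))) ∧ IsLUB (Set.range c) a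
  O3 : ∀ a' a b' b : S, WayBelow a' a → WayBelow b' b → WayBelow (a' + b') (a + b)
  O4 : ∀ (c d : ℕ → S) (s t : S), Monotone c → Monotone d →
      IsLUB (Set.range c) s → IsLUB (Set.range d) t →
      IsLUB (Set.range (fun n => c n + d n)) (s + t)

section WayBelowBasic

variable {S : Type*} [Preorder S]

theorem WayBelow.le {a b : S} (h : WayBelow a b) : a ≤ b := by
  obtain ⟨n, hn⟩ := h (fun _ => b) monotone_const b
    (by rw [Set.range_const]; exact isLUB_singleton) le_rfl
  exact hn

theorem WayBelow.of_le_left {x a b : S} (hx : x ≤ a) (h : WayBelow a b) : WayBelow x b :=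
  fun c hc s hs hbs => (h c hc s hs hbs).imp fun _ hn => hx.trans hn

theorem WayBelow.of_le_right {a b y : S} (h : WayBelow a b) (hy : b ≤ y) : WayBelow a y :=
  fun c hc s hs hys => h c hc s hs (hy.trans hys)

end WayBelowBasic

theorem wayBelow_zero {S : Type*} [AddCommMonoid S] [PartialOrder S] [CuSemigroup S] {a : S} :
    WayBelow (0 : S) a :=
  fun _ _ _ _ _ => ⟨0, CuSemigroup.zero_le' _⟩

/-- Interpolation: if `a' ≪ a` then there is `x` with `a' ≪ x ≪ a`. -/
theorem exists_interpolate {S : Type*} [AddCommMonoid S] [PartialOrder S] [CuSemigroup S]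
    {a' a : S} (h : WayBelow a' a) : ∃ x : S, WayBelow a' x ∧ WayBelow x a := by
  obtain ⟨c, hc, hlub⟩ := CuSemigroup.O2 a
  have hmono : Monotone c := monotone_nat_of_le_succ fun n => (hc n).le
  obtain ⟨n, hn⟩ := h c hmono a hlub le_rfl
  exact ⟨c (n + 1), WayBelow.of_le_left hn (hc n),
    WayBelow.of_le_right (hc (n + 1)) (hlub.1 (Set.mem_range_self (n + 2)))⟩

/-! ### Generalized Cu-morphisms -/

/-- A generalized `Cu`-morphism: additive, monotone, zero preserving map which preserves
suprema of increasing sequences. -/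
structure GenCuMor (S : Type*) (T : Type*) [AddCommMonoid S] [PartialOrder S]
    [AddCommMonoid T] [PartialOrder T] where
  toFun : S → T
  map_zero' : toFun 0 = 0
  map_add' : ∀ a b : S, toFun (a + b) = toFun a + toFun b
  mono' : Monotone toFun
  map_sup' : ∀ (c : ℕ → S) (s : S), Monotone c → IsLUB (Set.range c) s →
    IsLUB (Set.range (fun n => toFun (c n))) (toFun s)

namespace GenCuMor

variable {S T P : Type*} [AddCommMonoid S] [PartialOrder S] [AddCommMonoid T] [PartialOrder T]
  [AddCommMonoid P] [PartialOrder P]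

theorem ext' {f g : GenCuMor S T} (h : f.toFun = g.toFun) : f = g := by
  cases f; cases g; cases h; rfl

instance : PartialOrder (GenCuMor S T) where
  le f g := ∀ a : S, f.toFun a ≤ g.toFun a
  le_refl f a := le_rfl
  le_trans f g h h1 h2 a := (h1 a).trans (h2 a)
  le_antisymm f g h1 h2 := ext' (funext fun a => le_antisymm (h1 a) (h2 a))

theorem le_def {f g : GenCuMor S T} : f ≤ g ↔ ∀ a : S, f.toFun a ≤ g.toFun a := Iff.rfl

instance : Zero (GenCuMor S T) where
  zero :=
    { toFun := fun _ => 0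
      map_zero' := rfl
      map_add' := fun _ _ => (add_zero 0).symm
      mono' := monotone_const
      map_sup' := fun _ _ _ _ => by
        rw [Set.range_const]; exact isLUB_singleton }

@[simp] theorem zero_toFun (a : S) : (0 : GenCuMor S T).toFun a = 0 := rfl

instance [CuSemigroup T] : Add (GenCuMor S T) where
  add f g :=
    { toFun := fun a => f.toFun a + g.toFun a
      map_zero' := by show f.toFun 0 + g.toFun 0 = 0; rw [f.map_zero', g.map_zero', add_zero]
      map_add' := by
        intro a b
        show f.toFun (a + b) + g.toFun (a + b) = _
        rw [f.map_add', g.map_add', add_add_add_comm]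
      mono' := fun a b h => CuSemigroup.add_le_add' _ _ _ _ (f.mono' h) (g.mono' h)
      map_sup' := fun c s hc hs =>
        CuSemigroup.O4 (fun n => f.toFun (c n)) (fun n => g.toFun (c n)) _ _
          (fun _ _ h => f.mono' (hc h)) (fun _ _ h => g.mono' (hc h))
          (f.map_sup' c s hc hs) (g.map_sup' c s hc hs) }

@[simp] theorem add_toFun [CuSemigroup T] (f g : GenCuMor S T) (a : S) :
    (f + g).toFun a = f.toFun a + g.toFun a := rfl

instance [CuSemigroup T] : AddCommMonoid (GenCuMor S T) where
  add := (· + ·)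
  zero := 0
  add_assoc f g h := ext' (funext fun a => add_assoc (f.toFun a) (g.toFun a) (h.toFun a))
  zero_add f := ext' (funext fun a => zero_add (f.toFun a))
  add_zero f := ext' (funext fun a => add_zero (f.toFun a))
  add_comm f g := ext' (funext fun a => add_comm (f.toFun a) (g.toFun a))
  nsmul := nsmulRec
  nsmul_zero := fun _ => rfl
  nsmul_succ := fun _ _ => rfl

/-- Composition of generalized Cu-morphisms. -/
def comp (g : GenCuMor T P) (f : GenCuMor S T) : GenCuMor S P where
  toFun := fun a => g.toFun (f.toFun a)
  map_zero' := by show g.toFun (f.toFun 0) = 0; rw [f.map_zero', g.map_zero']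
  map_add' := fun a b => by
    show g.toFun (f.toFun (a + b)) = g.toFun (f.toFun a) + g.toFun (f.toFun b)
    rw [f.map_add', g.map_add']
  mono' := fun a b h => g.mono' (f.mono' h)
  map_sup' := fun c s hc hs =>
    g.map_sup' (fun n => f.toFun (c n)) (f.toFun s) (fun _ _ h => f.mono' (hc h))
      (f.map_sup' c s hc hs)

@[simp] theorem comp_toFun (g : GenCuMor T P) (f : GenCuMor S T) (a : S) :
    (g.comp f).toFun a = g.toFun (f.toFun a) := rfl

/-- The identity generalized Cu-morphism. -/
def id (S : Type*) [AddCommMonoid S] [PartialOrder S] : GenCuMor S S where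
  toFun := fun a => a
  map_zero' := rfl
  map_add' := fun _ _ => rfl
  mono' := monotone_id
  map_sup' := fun _ _ _ hs => hs

end GenCuMor

/-- The auxiliary relation `f ≺ g` on generalized Cu-morphisms. -/
def Prec {S T : Type*} [AddCommMonoid S] [PartialOrder S] [AddCommMonoid T] [PartialOrder T]
    (f g : GenCuMor S T) : Prop :=
  ∀ a' a : S, WayBelow a' a → WayBelow (f.toFun a') (g.toFun a)

namespace Prec

variable {S T P : Type*} [AddCommMonoid S] [PartialOrder S] [AddCommMonoid T] [PartialOrder T]
  [AddCommMonoid P] [PartialOrder P]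

theorem trans [CuSemigroup S] {f g h : GenCuMor S T} (h1 : Prec f g) (h2 : Prec g h) :
    Prec f h := by
  intro a' a ha
  obtain ⟨x, hx1, hx2⟩ := exists_interpolate ha
  exact WayBelow.of_le_left (h1 a' x hx1).le (h2 x a hx2)

theorem add [CuSemigroup T] {f g f' g' : GenCuMor S T} (h : Prec f g) (h' : Prec f' g') :
    Prec (f + f') (g + g') :=
  fun a' a ha => CuSemigroup.O3 _ _ _ _ (h a' a ha) (h' a' a ha)

theorem comp {f f' : GenCuMor S T} {g g' : GenCuMor T P} (hf : Prec f f') (hg : Prec g g') :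
    Prec (g.comp f) (g'.comp f') :=
  fun a' a ha => hg _ _ (hf a' a ha)

end Prec

/-! ### Paths and the bivariant Cu-semigroup -/

/-- The index set `ℚ ∩ (0,1)` for paths. -/
abbrev IQ : Type := {q : ℚ // 0 < q ∧ q < 1}

theorem IQ.exists_gt (l : IQ) : ∃ m : IQ, l.1 < m.1 := by
  refine ⟨⟨(l.1 + 1) / 2, ⟨by linarith [l.2.1, l.2.2], by linarith [l.2.2]⟩⟩, ?_⟩
  simp only
  linarith [l.2.2]

theorem IQ.exists_gt₂ (l m : IQ) : ∃ r : IQ, l.1 < r.1 ∧ m.1 < r.1 := by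
  have h1 : l.1 ≤ max l.1 m.1 := le_max_left _ _
  have h2 : m.1 ≤ max l.1 m.1 := le_max_right _ _
  have ht : max l.1 m.1 < 1 := max_lt l.2.2 m.2.2
  have ht0 : 0 < max l.1 m.1 := lt_of_lt_of_le l.2.1 h1
  refine ⟨⟨(max l.1 m.1 + 1) / 2, ⟨by linarith, by linarith⟩⟩, ?_, ?_⟩ <;>
    simp only <;> linarith

/-- A path of generalized Cu-morphisms: a `ℚ ∩ (0,1)`-indexed family which is increasing
with respect to the auxiliary relation `≺`. -/
structure CuPath (S T : Type*) [AddCommMonoid S] [PartialOrder S]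
    [AddCommMonoid T] [PartialOrder T] where
  f : IQ → GenCuMor S T
  prec : ∀ l m : IQ, l.1 < m.1 → Prec (f l) (f m)

namespace CuPath

variable {S T P : Type*} [AddCommMonoid S] [PartialOrder S] [AddCommMonoid T] [PartialOrder T]
  [AddCommMonoid P] [PartialOrder P]

theorem ext' {p q : CuPath S T} (h : p.f = q.f) : p = q := by
  cases p; cases q; cases h; rfl

end CuPath

/-- The preorder `f ≾ g` on paths. -/
def PathLE {S T : Type*} [AddCommMonoid S] [PartialOrder S] [AddCommMonoid T] [PartialOrder T]
    (p q : CuPath S T) : Prop :=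
  ∀ l : IQ, ∃ m : IQ, Prec (p.f l) (q.f m)

/-- The equivalence relation on paths: `p ∼ q` iff `p ≾ q` and `q ≾ p`. -/
def PathEquiv {S T : Type*} [AddCommMonoid S] [PartialOrder S] [AddCommMonoid T] [PartialOrder T]
    (p q : CuPath S T) : Prop :=
  PathLE p q ∧ PathLE q p

namespace PathLE

variable {S T : Type*} [AddCommMonoid S] [PartialOrder S] [AddCommMonoid T] [PartialOrder T]

theorem refl (p : CuPath S T) : PathLE p p := fun l =>
  let ⟨m, hm⟩ := IQ.exists_gt l
  ⟨m, p.prec l m hm⟩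

theorem trans [CuSemigroup S] {p q r : CuPath S T} (h1 : PathLE p q) (h2 : PathLE q r) :
    PathLE p r := fun l =>
  let ⟨m, hm⟩ := h1 l
  let ⟨n, hn⟩ := h2 m
  ⟨n, hm.trans hn⟩

end PathLE

instance CuPath.setoid (S T : Type*) [AddCommMonoid S] [PartialOrder S] [AddCommMonoid T]
    [PartialOrder T] [CuSemigroup S] : Setoid (CuPath S T) where
  r := PathEquiv
  iseqv :=
    { refl := fun p => ⟨PathLE.refl p, PathLE.refl p⟩
      symm := fun h => ⟨h.2, h.1⟩
      trans := fun h1 h2 => ⟨h1.1.trans h2.1, h2.2.trans h1.2⟩ }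

/-- The bivariant Cu-semigroup `⟦S,T⟧`: equivalence classes of paths. -/
def BivCu (S T : Type*) [AddCommMonoid S] [PartialOrder S] [AddCommMonoid T] [PartialOrder T]
    [CuSemigroup S] : Type _ :=
  Quotient (CuPath.setoid S T)

namespace BivCu

variable {S T P Q : Type*} [AddCommMonoid S] [PartialOrder S] [AddCommMonoid T] [PartialOrder T]
  [AddCommMonoid P] [PartialOrder P] [AddCommMonoid Q] [PartialOrder Q]

/-- Class of a path in the bivariant Cu-semigroup. -/
def mk [CuSemigroup S] (p : CuPath S T) : BivCu S T := Quotient.mk (CuPath.setoid S T) p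

instance [CuSemigroup S] : PartialOrder (BivCu S T) where
  le := Quotient.lift₂ PathLE (by
    intro p q p' q' hp hq
    exact propext ⟨fun h => (hp.2.trans h).trans hq.1, fun h => (hp.1.trans h).trans hq.2⟩)
  le_refl := by
    rintro ⟨p⟩
    exact PathLE.refl p
  le_trans := by
    rintro ⟨p⟩ ⟨q⟩ ⟨r⟩ h1 h2
    exact PathLE.trans h1 h2
  le_antisymm := by
    rintro ⟨p⟩ ⟨q⟩ h1 h2
    exact Quotient.sound ⟨h1, h2⟩

theorem mk_le_mk [CuSemigroup S] {p q : CuPath S T} : mk p ≤ mk q ↔ PathLE p q := Iff.rfl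

end BivCu

/-- Pointwise addition of paths. -/
def CuPath.add {S T : Type*} [AddCommMonoid S] [PartialOrder S] [AddCommMonoid T]
    [PartialOrder T] [CuSemigroup T] (p q : CuPath S T) : CuPath S T where
  f l := p.f l + q.f l
  prec l m h := (p.prec l m h).add (q.prec l m h)

/-- The zero path. -/
def CuPath.zero (S T : Type*) [AddCommMonoid S] [PartialOrder S] [AddCommMonoid T]
    [PartialOrder T] [CuSemigroup T] : CuPath S T where
  f _ := 0
  prec _ _ _ := fun _ _ _ => wayBelow_zero

theorem PathLE.add {S T : Type*} [AddCommMonoid S] [PartialOrder S] [AddCommMonoid T]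
    [PartialOrder T] [CuSemigroup S] [CuSemigroup T] {p p' q q' : CuPath S T}
    (hp : PathLE p p') (hq : PathLE q q') : PathLE (p.add q) (p'.add q') := by
  intro l
  obtain ⟨m1, h1⟩ := hp l
  obtain ⟨m2, h2⟩ := hq l
  obtain ⟨r, hr1, hr2⟩ := IQ.exists_gt₂ m1 m2
  exact ⟨r, (h1.trans (p'.prec m1 r hr1)).add (h2.trans (q'.prec m2 r hr2))⟩

theorem PathEquiv.add {S T : Type*} [AddCommMonoid S] [PartialOrder S] [AddCommMonoid T]
    [PartialOrder T] [CuSemigroup S] [CuSemigroup T] {p p' q q' : CuPath S T}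
    (hp : PathEquiv p p') (hq : PathEquiv q q') : PathEquiv (p.add q) (p'.add q') :=
  ⟨PathLE.add hp.1 hq.1, PathLE.add hp.2 hq.2⟩

namespace BivCu

variable {S T P : Type*} [AddCommMonoid S] [PartialOrder S] [AddCommMonoid T] [PartialOrder T]
  [AddCommMonoid P] [PartialOrder P]

instance [CuSemigroup S] [CuSemigroup T] : Add (BivCu S T) where
  add := Quotient.map₂ CuPath.add (fun _ _ hp _ _ hq => PathEquiv.add hp hq)

instance [CuSemigroup S] [CuSemigroup T] : Zero (BivCu S T) where
  zero := mk (CuPath.zero S T)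

instance [CuSemigroup S] [CuSemigroup T] : AddCommMonoid (BivCu S T) where
  add := (· + ·)
  zero := 0
  add_assoc := by
    rintro ⟨p⟩ ⟨q⟩ ⟨r⟩
    exact congrArg (Quotient.mk _) (CuPath.ext' (funext fun l => add_assoc _ _ _))
  zero_add := by
    rintro ⟨p⟩
    exact congrArg (Quotient.mk _) (CuPath.ext' (funext fun l => zero_add _))
  add_zero := by
    rintro ⟨p⟩
    exact congrArg (Quotient.mk _) (CuPath.ext' (funext fun l => add_zero _))
  add_comm := by
    rintro ⟨p⟩ ⟨q⟩
    exact congrArg (Quotient.mk _) (CuPath.ext' (funext fun l => add_comm _ _))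
  nsmul := nsmulRec
  nsmul_zero := fun _ => rfl
  nsmul_succ := fun _ _ => rfl

theorem mk_add_mk [CuSemigroup S] [CuSemigroup T] (p q : CuPath S T) :
    mk p + mk q = mk (p.add q) := rfl

end BivCu

/-- Composition of paths. -/
def CuPath.comp {S T P : Type*} [AddCommMonoid S] [PartialOrder S] [AddCommMonoid T]
    [PartialOrder T] [AddCommMonoid P] [PartialOrder P]
    (q : CuPath T P) (p : CuPath S T) : CuPath S P where
  f l := (q.f l).comp (p.f l)
  prec l m h := Prec.comp (p.prec l m h) (q.prec l m h)

theorem PathLE.comp {S T P : Type*} [AddCommMonoid S] [PartialOrder S] [AddCommMonoid T]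
    [PartialOrder T] [AddCommMonoid P] [PartialOrder P] [CuSemigroup S] [CuSemigroup T]
    {q q' : CuPath T P} {p p' : CuPath S T} (hq : PathLE q q') (hp : PathLE p p') :
    PathLE (q.comp p) (q'.comp p') := by
  intro l
  obtain ⟨m1, h1⟩ := hp l
  obtain ⟨m2, h2⟩ := hq l
  obtain ⟨r, hr1, hr2⟩ := IQ.exists_gt₂ m1 m2
  exact ⟨r, Prec.comp (h1.trans (p'.prec m1 r hr1)) (h2.trans (q'.prec m2 r hr2))⟩

theorem PathEquiv.comp {S T P : Type*} [AddCommMonoid S] [PartialOrder S] [AddCommMonoid T]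
    [PartialOrder T] [AddCommMonoid P] [PartialOrder P] [CuSemigroup S] [CuSemigroup T]
    {q q' : CuPath T P} {p p' : CuPath S T} (hq : PathEquiv q q') (hp : PathEquiv p p') :
    PathEquiv (q.comp p) (q'.comp p') :=
  ⟨PathLE.comp hq.1 hp.1, PathLE.comp hq.2 hp.2⟩

/-- The composition product on bivariant Cu-semigroups. -/
def BivCu.comp {S T P : Type*} [AddCommMonoid S] [PartialOrder S] [AddCommMonoid T]
    [PartialOrder T] [AddCommMonoid P] [PartialOrder P] [CuSemigroup S] [CuSemigroup T]
    (y : BivCu T P) (x : BivCu S T) : BivCu S P :=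
  Quotient.map₂ CuPath.comp (fun _ _ hq _ _ hp => PathEquiv.comp hq hp) y x

theorem BivCu.comp_mk_mk {S T P : Type*} [AddCommMonoid S] [PartialOrder S] [AddCommMonoid T]
    [PartialOrder T] [AddCommMonoid P] [PartialOrder P] [CuSemigroup S] [CuSemigroup T]
    (q : CuPath T P) (p : CuPath S T) :
    BivCu.comp (BivCu.mk q) (BivCu.mk p) = BivCu.mk (q.comp p) := rfl

/-- The constant path at the identity morphism. -/
def CuPath.id (S : Type*) [AddCommMonoid S] [PartialOrder S] : CuPath S S where
  f _ := GenCuMor.id S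
  prec _ _ _ := fun _ _ ha => ha

/-- The class of the constant path at the identity: the unit of `⟦S,S⟧`. -/
def BivCu.id (S : Type*) [AddCommMonoid S] [PartialOrder S] [CuSemigroup S] : BivCu S S :=
  BivCu.mk (CuPath.id S)

/-! ### Ideals, morphism predicates, bimorphisms, softness, elementary paths -/

/-- An ideal of a Cu-semigroup: a downward hereditary submonoid closed under
suprema of increasing sequences. -/
def IsCuIdeal {S : Type*} [AddCommMonoid S] [PartialOrder S] (J : Set S) : Prop :=
  (0 : S) ∈ J ∧ (∀ a b : S, a ∈ J → b ∈ J → a + b ∈ J) ∧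
  (∀ a b : S, b ≤ a → a ∈ J → b ∈ J) ∧
  (∀ c : ℕ → S, Monotone c → (∀ n, c n ∈ J) → ∀ s : S, IsLUB (Set.range c) s → s ∈ J)

/-- Predicate: `f` is (the function of) a generalized Cu-morphism. -/
def IsGenCuMorFun {S T : Type*} [AddCommMonoid S] [PartialOrder S] [AddCommMonoid T]
    [PartialOrder T] (f : S → T) : Prop :=
  f 0 = 0 ∧ (∀ a b : S, f (a + b) = f a + f b) ∧ Monotone f ∧
  ∀ (c : ℕ → S) (s : S), Monotone c → IsLUB (Set.range c) s →
    IsLUB (Set.range (fun n => f (c n))) (f s)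

/-- Predicate: `f` is a Cu-morphism (generalized Cu-morphism preserving way-below). -/
def IsCuMorFun {S T : Type*} [AddCommMonoid S] [PartialOrder S] [AddCommMonoid T]
    [PartialOrder T] (f : S → T) : Prop :=
  IsGenCuMorFun f ∧ ∀ a b : S, WayBelow a b → WayBelow (f a) (f b)

/-- Predicate: `φ` is a Cu-bimorphism. -/
def IsCuBimor {A B C : Type*} [AddCommMonoid A] [PartialOrder A] [AddCommMonoid B]
    [PartialOrder B] [AddCommMonoid C] [PartialOrder C] (φ : A → B → C) : Prop :=
  (∀ b : B, φ 0 b = 0) ∧ (∀ a : A, φ a 0 = 0) ∧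
  (∀ (a a' : A) (b : B), φ (a + a') b = φ a b + φ a' b) ∧
  (∀ (a : A) (b b' : B), φ a (b + b') = φ a b + φ a b') ∧
  (∀ (a a' : A) (b : B), a ≤ a' → φ a b ≤ φ a' b) ∧
  (∀ (a : A) (b b' : B), b ≤ b' → φ a b ≤ φ a b') ∧
  (∀ (c : ℕ → A) (d : ℕ → B) (s : A) (t : B), Monotone c → Monotone d →
    IsLUB (Set.range c) s → IsLUB (Set.range d) t →
    IsLUB (Set.range (fun n => φ (c n) (d n))) (φ s t)) ∧
  (∀ (a' a : A) (b' b : B), WayBelow a' a → WayBelow b' b → WayBelow (φ a' b') (φ a b))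

/-- A path in `(R, ≪)`: a `ℚ ∩ (0,1)`-indexed family, increasing with respect to
the way-below relation. -/
structure ElemPath (R : Type*) [Preorder R] where
  f : IQ → R
  prec : ∀ l m : IQ, l.1 < m.1 → WayBelow (f l) (f m)

/-- A soft element of a Cu-semigroup. -/
def IsSoft {S : Type*} [AddCommMonoid S] [PartialOrder S] (a : S) : Prop :=
  ∀ a' : S, WayBelow a' a → ∃ k : ℕ, (k + 1) • a' ≤ k • a

/-! ### Cofinal sequences of indices -/

namespace IQ

theorem exists_gt_forall_lt (h : ℕ → IQ) (n : ℕ) (x : IQ) :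
    ∃ r : IQ, x.1 < r.1 ∧ ∀ k < n, (h k).1 < r.1 := by
  induction n with
  | zero =>
    obtain ⟨r, hr⟩ := exists_gt x
    exact ⟨r, hr, fun k hk => absurd hk k.not_lt_zero⟩
  | succ n ih =>
    obtain ⟨r, hxr, hr⟩ := ih
    obtain ⟨r', h1, h2⟩ := exists_gt₂ r (h n)
    refine ⟨r', hxr.trans h1, fun k hk => ?_⟩
    rcases Nat.lt_succ_iff_lt_or_eq.mp hk with hk | rfl
    · exact (hr k hk).trans h1
    · exact h2

/-- The cofinal sequence `1 - 1 / (n + 2)` of indices. -/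
def cofinalSeq (n : ℕ) : IQ :=
  ⟨1 - 1 / ((n : ℚ) + 2), by
    have h : (0 : ℚ) < (n : ℚ) + 2 := by positivity
    constructor
    · rw [sub_pos, div_lt_one h]
      linarith [Nat.cast_nonneg (α := ℚ) n]
    · have : (0 : ℚ) < 1 / ((n : ℚ) + 2) := by positivity
      linarith⟩

theorem cofinalSeq_lt {m n : ℕ} (h : m < n) : (cofinalSeq m).1 < (cofinalSeq n).1 := by
  have h' : (m : ℚ) < n := by exact_mod_cast h
  have : 1 / ((n : ℚ) + 2) < 1 / ((m : ℚ) + 2) :=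
    one_div_lt_one_div_of_lt (by positivity) (by linarith)
  simp only [cofinalSeq]
  linarith

theorem exists_lt_cofinalSeq (l : IQ) : ∃ N : ℕ, ∀ n ≥ N, l.1 < (cofinalSeq n).1 := by
  obtain ⟨N, hN⟩ := exists_nat_one_div_lt (sub_pos.mpr l.2.2)
  refine ⟨N, fun n hn => ?_⟩
  have h' : (N : ℚ) ≤ n := by exact_mod_cast hn
  have : 1 / ((n : ℚ) + 2) ≤ 1 / ((N : ℚ) + 1) :=
    one_div_le_one_div_of_le (by positivity) (by linarith)
  simp only [cofinalSeq]
  linarith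

/-- The increasing bijection `l ↦ l / (1 - l)` from `ℚ ∩ (0,1)` onto the positive rationals. -/
def odds (l : IQ) : ℚ := l.1 / (1 - l.1)

theorem odds_nonneg (l : IQ) : 0 ≤ l.odds :=
  div_nonneg l.2.1.le (sub_pos.mpr l.2.2).le

theorem odds_lt {l m : IQ} (h : l.1 < m.1) : l.odds < m.odds := by
  have h1 := sub_pos.mpr l.2.2
  have h2 := sub_pos.mpr m.2.2
  rw [odds, odds, div_lt_div_iff₀ h1 h2]
  linarith

theorem exists_odds_eq {t : ℚ} (ht : 0 < t) : ∃ l : IQ, l.odds = t := by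
  have h : 0 < 1 + t := by linarith
  refine ⟨⟨t / (1 + t), by positivity, by rw [div_lt_one h]; linarith⟩, ?_⟩
  simp only [odds]
  field_simp
  ring

/-- The point of the segment `[a, b)` at position `t - ⌊t⌋`. -/
def interp (a b : IQ) (hab : a.1 < b.1) (t : ℚ) : IQ :=
  ⟨a.1 + Int.fract t * (b.1 - a.1), by
    have h0 := Int.fract_nonneg t
    have h1 := Int.fract_lt_one t
    have hp := mul_nonneg h0 (sub_pos.mpr hab).le
    have hq := mul_lt_of_lt_one_left (sub_pos.mpr hab) h1
    exact ⟨by linarith [a.2.1], by linarith [b.2.2]⟩⟩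

theorem le_interp {a b : IQ} (hab : a.1 < b.1) (t : ℚ) : a.1 ≤ (interp a b hab t).1 :=
  le_add_of_nonneg_right (mul_nonneg (Int.fract_nonneg t) (sub_pos.mpr hab).le)

theorem interp_lt {a b : IQ} (hab : a.1 < b.1) (t : ℚ) : (interp a b hab t).1 < b.1 := by
  have := mul_lt_of_lt_one_left (sub_pos.mpr hab) (Int.fract_lt_one t)
  simp only [interp]
  linarith

theorem interp_lt_interp {a b : IQ} (hab : a.1 < b.1) {t u : ℚ}
    (h : Int.fract t < Int.fract u) : (interp a b hab t).1 < (interp a b hab u).1 := by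
  have := mul_lt_mul_of_pos_right h (sub_pos.mpr hab)
  simp only [interp]
  linarith

end IQ

/-! ### Suprema of increasing sequences in the bivariant Cu-semigroup -/

section

variable {S T P : Type*} [AddCommMonoid S] [PartialOrder S] [AddCommMonoid T] [PartialOrder T]
  [AddCommMonoid P] [PartialOrder P]

theorem Prec.le [CuSemigroup S] {f g : GenCuMor S T} (h : Prec f g) : f ≤ g := by
  intro a
  obtain ⟨c, hc, hlub⟩ := CuSemigroup.O2 a
  refine (f.map_sup' c a (monotone_nat_of_le_succ fun n => (hc n).le) hlub).2 ?_
  rintro _ ⟨n, rfl⟩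
  exact (h _ _ ((hc n).of_le_right (hlub.1 ⟨n + 1, rfl⟩))).le

theorem CuPath.prec_of_prec_of_le [CuSemigroup S] {g : GenCuMor S T} (p : CuPath S T) {l m : IQ}
    (h : Prec g (p.f l)) (hlm : l.1 ≤ m.1) : Prec g (p.f m) := by
  rcases hlm.eq_or_lt with heq | hlt
  · rwa [← Subtype.ext heq]
  · exact h.trans (p.prec _ _ hlt)

/-- Indices along which an increasing sequence of paths can be glued to a single path. -/
theorem exists_gluing_indices [CuSemigroup S] (p : ℕ → CuPath S T)
    (hp : ∀ k n, k ≤ n → PathLE (p k) (p n)) :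
    ∃ a b : ℕ → IQ, (∀ n, (a n).1 < (b n).1) ∧
      (∀ n, Prec ((p n).f (b n)) ((p (n + 1)).f (a (n + 1)))) ∧
      ∀ k n, k ≤ n → Prec ((p k).f (IQ.cofinalSeq n)) ((p n).f (b n)) := by
  have hstep : ∀ n l, ∃ m, Prec ((p n).f l) ((p (n + 1)).f m) :=
    fun n l => hp n (n + 1) n.le_succ l
  have hbound : ∀ (n : ℕ) (x : IQ), ∃ r : IQ, x.1 < r.1 ∧
      ∀ k ≤ n, Prec ((p k).f (IQ.cofinalSeq n)) ((p n).f r) := by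
    intro n x
    have : ∀ k, ∃ m, k ≤ n → Prec ((p k).f (IQ.cofinalSeq n)) ((p n).f m) := by
      intro k
      by_cases hk : k ≤ n
      · exact (hp k n hk _).imp fun _ h _ => h
      · exact ⟨x, fun h => absurd h hk⟩
    choose m hm using this
    obtain ⟨r, hxr, hr⟩ := IQ.exists_gt_forall_lt m (n + 1) x
    exact ⟨r, hxr, fun k hk =>
      (p n).prec_of_prec_of_le (hm k hk) (hr k (Nat.lt_succ_of_le hk)).le⟩
  choose φ hφ using hstep
  choose ψ hψ hψ' using hbound
  let a : ℕ → IQ := Nat.rec (IQ.cofinalSeq 0) fun n x => φ n (ψ n x)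
  exact ⟨a, fun n => ψ n (a n), fun n => hψ n (a n), fun n => hφ n (ψ n (a n)),
    fun k n hk => hψ' n (a n) k hk⟩

/-- Every increasing sequence in `⟦S,T⟧` has a supremum, represented by a path whose members
are members of paths representing the sequence. -/
theorem BivCu.exists_path_isLUB [CuSemigroup S] (p : ℕ → CuPath S T)
    (hp : Monotone fun n => BivCu.mk (p n)) :
    ∃ f : CuPath S T, IsLUB (Set.range fun n => BivCu.mk (p n)) (BivCu.mk f) ∧
      ∀ l, ∃ n m, f.f l = (p n).f m := by
  obtain ⟨a, b, hab, hstep, hcof⟩ := exists_gluing_indices p fun k n hk => hp hk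
  have hchain : ∀ n m, n < m → Prec ((p n).f (b n)) ((p m).f (a m)) := by
    intro n m hnm
    induction m, hnm using Nat.le_induction with
    | base => exact hstep n
    | succ m _ ih => exact (ih.trans ((p m).prec _ _ (hab m))).trans (hstep m)
  let F : ℚ → GenCuMor S T := fun t => (p ⌊t⌋₊).f (IQ.interp _ _ (hab ⌊t⌋₊) t)
  have hF : ∀ t u, 0 ≤ t → t < u → Prec (F t) (F u) := by
    intro t u ht htu
    rcases (Nat.floor_mono htu.le).eq_or_lt with heq | hlt
    · have hfr : Int.fract t < Int.fract u := by
        have h1 := natCast_floor_eq_intCast_floor (R := ℚ) ht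
        have h2 := natCast_floor_eq_intCast_floor (R := ℚ) (ht.trans htu.le)
        rw [heq, h2] at h1
        rw [Int.fract, Int.fract, h1]
        linarith
      simp only [F]
      rw [← heq]
      exact (p _).prec _ _ (IQ.interp_lt_interp _ hfr)
    · exact (p _).prec_of_prec_of_le
        (((p _).prec _ _ (IQ.interp_lt _ t)).trans (hchain _ _ hlt)) (IQ.le_interp _ u)
  let f : CuPath S T :=
    { f := fun l => F l.odds
      prec := fun l m h => hF _ _ l.odds_nonneg (IQ.odds_lt h) }
  refine ⟨f, ⟨?_, ?_⟩, fun l => ⟨_, _, rfl⟩⟩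
  · rintro _ ⟨k, rfl⟩ l
    obtain ⟨N, hN⟩ := IQ.exists_lt_cofinalSeq l
    obtain ⟨m, hm⟩ := IQ.exists_odds_eq (t := ((max k N + 1 : ℕ) : ℚ)) (by positivity)
    refine ⟨m, ?_⟩
    have hfm : f.f m = F m.odds := rfl
    have h1 := ((p k).prec _ _ (hN _ (le_max_right k N))).trans (hcof k _ (le_max_left k N))
    rw [hfm, hm]
    simp only [F]
    rw [Nat.floor_natCast]
    exact (p _).prec_of_prec_of_le (h1.trans (hstep _)) (IQ.le_interp _ _)
  · intro s hs
    obtain ⟨q, rfl⟩ := Quotient.exists_rep s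
    exact fun l => hs ⟨_, rfl⟩ _

/-- The restriction of a path to the indices below `m`, reparametrised linearly. -/
def CuPath.cut (p : CuPath S T) (m : IQ) : CuPath S T where
  f l := p.f ⟨l.1 * m.1, mul_pos l.2.1 m.2.1, mul_lt_one_of_nonneg_of_lt_one_left l.2.1.le l.2.2
    m.2.2.le⟩
  prec _ _ h := p.prec _ _ (mul_lt_mul_of_pos_right h m.2.1)

theorem CuPath.cut_prec (p : CuPath S T) (l m : IQ) : Prec ((p.cut m).f l) (p.f m) :=
  p.prec _ _ (mul_lt_of_lt_one_left m.2.1 l.2.2)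

theorem CuPath.exists_prec_cut [CuSemigroup S] (p : CuPath S T) {l m : IQ} (h : l.1 < m.1) :
    ∃ r, Prec (p.f l) ((p.cut m).f r) := by
  obtain ⟨c, hlc, hcm⟩ := exists_between h
  have hc := l.2.1.trans hlc
  refine ⟨⟨c / m.1, div_pos hc m.2.1, (div_lt_one m.2.1).mpr hcm⟩, p.prec _ _ ?_⟩
  exact hlc.trans_eq (div_mul_cancel₀ c m.2.1.ne').symm

theorem CuPath.isLUB_cut [CuSemigroup S] (p : CuPath S T) :
    IsLUB (Set.range fun n => BivCu.mk (p.cut (IQ.cofinalSeq n))) (BivCu.mk p) := by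
  constructor
  · rintro _ ⟨n, rfl⟩ l
    exact ⟨_, p.cut_prec l _⟩
  · intro s hs
    obtain ⟨q, rfl⟩ := Quotient.exists_rep s
    intro l
    obtain ⟨N, hN⟩ := IQ.exists_lt_cofinalSeq l
    obtain ⟨r, hr⟩ := p.exists_prec_cut (hN N le_rfl)
    obtain ⟨m, hm⟩ := hs ⟨N, rfl⟩ r
    exact ⟨m, hr.trans hm⟩

theorem CuPath.monotone_cut [CuSemigroup S] (p : CuPath S T) :
    Monotone fun n => BivCu.mk (p.cut (IQ.cofinalSeq n)) := by
  refine monotone_nat_of_le_succ fun n l => ?_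
  obtain ⟨r, hr⟩ := p.exists_prec_cut (IQ.cofinalSeq_lt n.lt_succ_self)
  exact ⟨r, (p.cut_prec l _).trans hr⟩

/-- If `[q] ≪ [p]`, then all members of `q` lie below a single member of `p`. -/
theorem BivCu.exists_forall_le_of_wayBelow [CuSemigroup S] {q p : CuPath S T}
    (h : WayBelow (BivCu.mk q) (BivCu.mk p)) : ∃ m, ∀ l, q.f l ≤ p.f m := by
  obtain ⟨n, hn⟩ := h _ p.monotone_cut _ p.isLUB_cut le_rfl
  refine ⟨IQ.cofinalSeq n, fun l => ?_⟩
  obtain ⟨r, hr⟩ := hn l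
  exact (hr.trans (p.cut_prec r _)).le

/-! ### The endpoint map -/

namespace CuPath

theorem mono [CuSemigroup S] (p : CuPath S T) {l m : IQ} (h : l.1 ≤ m.1) : p.f l ≤ p.f m := by
  rcases h.eq_or_lt with heq | hlt
  · rw [Subtype.ext heq]
  · exact (p.prec l m hlt).le

theorem monotone_cofinalSeq [CuSemigroup S] (p : CuPath S T) (a : S) :
    Monotone fun n => (p.f (IQ.cofinalSeq n)).toFun a :=
  monotone_nat_of_le_succ fun n => (p.prec _ _ (IQ.cofinalSeq_lt n.lt_succ_self)).le a

theorem isLUB_cofinalSeq_iff [CuSemigroup S] (p : CuPath S T) (a : S) {s : T} :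
    IsLUB (Set.range fun n => (p.f (IQ.cofinalSeq n)).toFun a) s ↔
      IsLUB (Set.range fun l => (p.f l).toFun a) s := by
  refine isLUB_congr (Set.ext fun u => ⟨?_, ?_⟩)
  · rintro h _ ⟨l, rfl⟩
    obtain ⟨N, hN⟩ := IQ.exists_lt_cofinalSeq l
    exact ((p.prec _ _ (hN N le_rfl)).le a).trans (h ⟨N, rfl⟩)
  · rintro h _ ⟨n, rfl⟩
    exact h ⟨_, rfl⟩

variable [CuSemigroup S] [CuSemigroup T]

theorem exists_isLUB (p : CuPath S T) (a : S) :
    ∃ s : T, IsLUB (Set.range fun l => (p.f l).toFun a) s := by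
  obtain ⟨s, hs⟩ := CuSemigroup.O1 _ (p.monotone_cofinalSeq a)
  exact ⟨s, (p.isLUB_cofinalSeq_iff a).mp hs⟩

/-- The endpoint of a path, evaluated at `a`. -/
noncomputable def endpoint (p : CuPath S T) (a : S) : T := (p.exists_isLUB a).choose

theorem isLUB_endpoint (p : CuPath S T) (a : S) :
    IsLUB (Set.range fun l => (p.f l).toFun a) (p.endpoint a) :=
  (p.exists_isLUB a).choose_spec

theorem le_endpoint (p : CuPath S T) (l : IQ) (a : S) : (p.f l).toFun a ≤ p.endpoint a :=
  (p.isLUB_endpoint a).1 ⟨l, rfl⟩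

theorem endpoint_le {p : CuPath S T} {a : S} {s : T} (h : ∀ l, (p.f l).toFun a ≤ s) :
    p.endpoint a ≤ s :=
  (p.isLUB_endpoint a).2 (by rintro _ ⟨l, rfl⟩; exact h l)

theorem isLUB_cofinalSeq (p : CuPath S T) (a : S) :
    IsLUB (Set.range fun n => (p.f (IQ.cofinalSeq n)).toFun a) (p.endpoint a) :=
  (p.isLUB_cofinalSeq_iff a).mpr (p.isLUB_endpoint a)

theorem endpoint_le_of_pathLE {p q : CuPath S T} (h : PathLE p q) (a : S) :
    p.endpoint a ≤ q.endpoint a :=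
  endpoint_le fun l =>
    let ⟨m, hm⟩ := h l
    (hm.le a).trans (q.le_endpoint m a)

theorem endpoint_mono (p : CuPath S T) : Monotone p.endpoint :=
  fun _ b h => endpoint_le fun l => ((p.f l).mono' h).trans (p.le_endpoint l b)

theorem endpoint_map_zero (p : CuPath S T) : p.endpoint 0 = 0 :=
  le_antisymm (endpoint_le fun l => (p.f l).map_zero'.le) (CuSemigroup.zero_le' _)

theorem endpoint_map_add (p : CuPath S T) (a b : S) :
    p.endpoint (a + b) = p.endpoint a + p.endpoint b := by
  refine (p.isLUB_cofinalSeq (a + b)).unique ?_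
  simp only [GenCuMor.map_add']
  exact CuSemigroup.O4 _ _ _ _ (p.monotone_cofinalSeq a) (p.monotone_cofinalSeq b)
    (p.isLUB_cofinalSeq a) (p.isLUB_cofinalSeq b)

theorem endpoint_zero (a : S) : (CuPath.zero S T).endpoint a = 0 :=
  le_antisymm (endpoint_le fun _ => le_rfl) (CuSemigroup.zero_le' _)

theorem endpoint_add (p q : CuPath S T) (a : S) :
    (p.add q).endpoint a = p.endpoint a + q.endpoint a :=
  ((p.add q).isLUB_cofinalSeq a).unique
    (CuSemigroup.O4 _ _ _ _ (p.monotone_cofinalSeq a) (q.monotone_cofinalSeq a)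
      (p.isLUB_cofinalSeq a) (q.isLUB_cofinalSeq a))

theorem endpoint_id (a : S) : (CuPath.id S).endpoint a = a :=
  le_antisymm (endpoint_le fun _ => le_rfl) ((CuPath.id S).le_endpoint (IQ.cofinalSeq 0) a)

theorem endpoint_comp [CuSemigroup P] (q : CuPath T P) (p : CuPath S T) (a : S) :
    (q.comp p).endpoint a = q.endpoint (p.endpoint a) := by
  refine le_antisymm (endpoint_le fun l => ?_) (endpoint_le fun l => ?_)
  · exact ((q.f l).mono' (p.le_endpoint l a)).trans (q.le_endpoint l _)
  · refine ((q.f l).map_sup' _ _ (p.monotone_cofinalSeq a) (p.isLUB_cofinalSeq a)).2 ?_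
    rintro _ ⟨n, rfl⟩
    obtain ⟨r, hlr, hnr⟩ := IQ.exists_gt₂ l (IQ.cofinalSeq n)
    exact ((q.mono hlr.le _).trans ((q.f r).mono' (p.mono hnr.le a))).trans
      ((q.comp p).le_endpoint r a)

end CuPath

variable [CuSemigroup S] [CuSemigroup T]

/-- The evaluation pairing `⟦S,T⟧ × S → T`. -/
noncomputable def BivCu.eval (x : BivCu S T) (a : S) : T :=
  Quotient.lift (fun p : CuPath S T => p.endpoint a)
    (fun p q (h : PathEquiv p q) => le_antisymm (CuPath.endpoint_le_of_pathLE h.1 a)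
      (CuPath.endpoint_le_of_pathLE h.2 a)) x

theorem BivCu.isLUB_eval (c : ℕ → BivCu S T) (d : ℕ → S) (s : BivCu S T) (t : S)
    (hc : Monotone c) (hd : Monotone d) (hs : IsLUB (Set.range c) s)
    (ht : IsLUB (Set.range d) t) :
    IsLUB (Set.range fun n => (c n).eval (d n)) (s.eval t) := by
  choose p hp using fun n => Quotient.exists_rep (c n)
  obtain rfl : (fun n => BivCu.mk (p n)) = c := funext hp
  obtain ⟨f, hf, hmem⟩ := BivCu.exists_path_isLUB p hc
  obtain rfl : s = BivCu.mk f := hs.unique hf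
  constructor
  · rintro _ ⟨n, rfl⟩
    exact (CuPath.endpoint_le_of_pathLE (hf.1 ⟨n, rfl⟩) (d n)).trans
      (f.endpoint_mono (ht.1 ⟨n, rfl⟩))
  · intro u hu
    refine CuPath.endpoint_le fun l => ((f.f l).map_sup' d t hd ht).2 ?_
    rintro _ ⟨k, rfl⟩
    obtain ⟨n, m, hfm⟩ := hmem l
    simp only [hfm]
    calc ((p n).f m).toFun (d k) ≤ (p n).endpoint (d k) := (p n).le_endpoint m _
      _ ≤ (p n).endpoint (d (max n k)) := (p n).endpoint_mono (hd (le_max_right n k))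
      _ ≤ (p (max n k)).endpoint (d (max n k)) :=
          CuPath.endpoint_le_of_pathLE (hc (le_max_left n k)) _
      _ ≤ u := hu ⟨max n k, rfl⟩

theorem BivCu.eval_wayBelow {x' x : BivCu S T} {b' b : S} (hx : WayBelow x' x)
    (hb : WayBelow b' b) : WayBelow (x'.eval b') (x.eval b) := by
  obtain ⟨q, rfl⟩ := Quotient.exists_rep x'
  obtain ⟨p, rfl⟩ := Quotient.exists_rep x
  obtain ⟨m, hm⟩ := BivCu.exists_forall_le_of_wayBelow hx
  obtain ⟨r, hr⟩ := IQ.exists_gt m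
  exact ((p.prec m r hr _ _ hb).of_le_left (CuPath.endpoint_le fun l => hm l b')).of_le_right
    (p.le_endpoint r b)

theorem BivCu.isCuBimor_eval : IsCuBimor (BivCu.eval : BivCu S T → S → T) := by
  refine ⟨CuPath.endpoint_zero, ?_, ?_, ?_, ?_, ?_, BivCu.isLUB_eval,
    fun _ _ _ _ => BivCu.eval_wayBelow⟩
  · rintro ⟨p⟩
    exact p.endpoint_map_zero
  · rintro ⟨p⟩ ⟨q⟩
    exact p.endpoint_add q
  · rintro ⟨p⟩
    exact p.endpoint_map_add
  · rintro ⟨p⟩ ⟨q⟩ b h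
    exact CuPath.endpoint_le_of_pathLE h b
  · rintro ⟨p⟩ b b' h
    exact p.endpoint_mono h

end

/-- For a Cu-semigroup `S`, the evaluation pairing
`⟦S,S⟧ × S → S`, `(x,a) ↦ x(a) = σ_{S,S}(x)(a)`, is a Cu-bimorphism and defines a left
action of the Cu-semiring `⟦S,S⟧` on `S`: `(y∘x)(a) = y(x(a))` and `⟨id_S⟩(a) = a`. -/
theorem evaluation_defines_left_action
    (S : Type*) [AddCommMonoid S] [PartialOrder S] [CuSemigroup S] :
    ∃ ev : BivCu S S → S → S,
      (∀ (p : CuPath S S) (a : S),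
        IsLUB (Set.range (fun l => (p.f l).toFun a)) (ev (BivCu.mk p) a)) ∧
      IsCuBimor ev ∧
      (∀ (x y : BivCu S S) (a : S), ev (BivCu.comp y x) a = ev y (ev x a)) ∧
      (∀ a : S, ev (BivCu.id S) a = a) := by
  refine ⟨BivCu.eval, fun p a => p.isLUB_endpoint a, BivCu.isCuBimor_eval, ?_,
    CuPath.endpoint_id⟩
  rintro ⟨p⟩ ⟨q⟩ a
  exact q.endpoint_comp p a
end

section
/- Let R be a Cu-semiring whose unit is a compact element, let S be a Cu-semigroup, and let T be a Cu-semigroup with a left R-action. For r ∈ R and x ∈ ⟦S,T⟧, choose a path (r_λ)_λ in (R,≪) with endpoint r and a path (f_λ)_λ in Cu[S,T] representing x; then the maps r_λ f_λ: S → T, a ↦ r_λ·f_λ(a), form a path in Cu[S,T] whose class depends only on r and x, and the assignment (r,x) ↦ r·x := [(r_λ f_λ)_λ] defines a left R-action on ⟦S,T⟧: it is a Cu-bimorphism R × ⟦S,T⟧ → ⟦S,T⟧ satisfying (rr')x = r(r'x) and 1x = x. -/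
/-! ### Reparametrization of paths -/

/-- The increasing affine map from `ℚ ∩ (0,1)` onto `ℚ ∩ (a,b)`. -/
def IQ.affine (a b : ℚ) (ha : 0 ≤ a) (hab : a < b) (hb : b ≤ 1) (l : IQ) : IQ :=
  ⟨a + (b - a) * l.1, by
    have h := mul_pos (sub_pos.2 hab) l.2.1
    have h' := mul_pos (sub_pos.2 hab) (sub_pos.2 l.2.2)
    constructor <;> linarith⟩

namespace IQ

variable {a b : ℚ} (ha : 0 ≤ a) (hab : a < b) (hb : b ≤ 1)

theorem affine_strictMono : StrictMono (IQ.affine a b ha hab hb) := fun l m h => by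
  have h' : l.1 < m.1 := h
  have := mul_lt_mul_of_pos_left h' (sub_pos.2 hab)
  show a + (b - a) * l.1 < a + (b - a) * m.1
  linarith

theorem lt_affine (l : IQ) : a < (IQ.affine a b ha hab hb l).1 := by
  have := mul_pos (sub_pos.2 hab) l.2.1
  show a < a + (b - a) * l.1
  linarith

theorem affine_lt (l : IQ) : (IQ.affine a b ha hab hb l).1 < b := by
  have := mul_pos (sub_pos.2 hab) (sub_pos.2 l.2.2)
  show a + (b - a) * l.1 < b
  linarith

theorem exists_affine_eq {m : IQ} (h1 : a < m.1) (h2 : m.1 < b) :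
    ∃ l, IQ.affine a b ha hab hb l = m := by
  have h0 : 0 < b - a := sub_pos.2 hab
  refine ⟨⟨(m.1 - a) / (b - a), div_pos (by linarith) h0, (div_lt_one h0).2 (by linarith)⟩,
    Subtype.ext ?_⟩
  show a + (b - a) * ((m.1 - a) / (b - a)) = m.1
  field_simp
  ring

instance : Nonempty IQ := ⟨⟨1 / 2, by norm_num, by norm_num⟩⟩

instance : NoMaxOrder IQ := ⟨fun l => IQ.exists_gt l⟩

instance : NoMinOrder IQ :=
  ⟨fun l => ⟨⟨l.1 / 2, by linarith [l.2.1], by linarith [l.2.1, l.2.2]⟩, by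
    show l.1 / 2 < l.1
    linarith [l.2.1]⟩⟩

instance : DenselyOrdered IQ :=
  ⟨fun l m h => by
    have h' : l.1 < m.1 := h
    refine ⟨⟨(l.1 + m.1) / 2, by linarith [l.2.1, m.2.1], by linarith [l.2.2, m.2.2]⟩, ?_, ?_⟩
    · show l.1 < (l.1 + m.1) / 2
      linarith
    · show (l.1 + m.1) / 2 < m.1
      linarith⟩

/-- An increasing sequence which is cofinal in `ℚ ∩ (0,1)`. -/
theorem exists_monotone_cofinal : ∃ t : ℕ → IQ, Monotone t ∧ ∀ l : IQ, ∃ n, l ≤ t n := by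
  obtain ⟨t, ht, htop⟩ := Filter.exists_seq_monotone_tendsto_atTop_atTop IQ
  exact ⟨t, ht, fun l => (htop.eventually_ge_atTop l).exists⟩

end IQ

namespace CuPath

variable {S T : Type*} [AddCommMonoid S] [PartialOrder S] [AddCommMonoid T] [PartialOrder T]

/-- The part of a path strictly below the index `l`, reparametrized. -/
def cut_s10 (p : CuPath S T) (l : IQ) : CuPath S T where
  f m := p.f (IQ.affine 0 l.1 le_rfl l.2.1 l.2.2.le m)
  prec _ _ h := p.prec _ _ (IQ.affine_strictMono le_rfl l.2.1 l.2.2.le h)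

theorem cut_prec_s10 (p : CuPath S T) (l m : IQ) : Prec ((p.cut_s10 l).f m) (p.f l) :=
  p.prec _ _ (IQ.affine_lt le_rfl l.2.1 l.2.2.le m)

theorem exists_cut_eq (p : CuPath S T) {l m : IQ} (h : m.1 < l.1) :
    ∃ k, (p.cut_s10 l).f k = p.f m := by
  obtain ⟨k, hk⟩ := IQ.exists_affine_eq le_rfl l.2.1 l.2.2.le m.2.1 h
  exact ⟨k, congrArg p.f hk⟩

/-- A family indexed by any countable dense linear order without endpoints, increasing with respect
to `≺`, can be reindexed to a path. -/
theorem exists_reindex {J : Type*} [LinearOrder J] [Countable J] [DenselyOrdered J] [NoMinOrder J]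
    [NoMaxOrder J] [Nonempty J] (G : J → GenCuMor S T) (hG : ∀ x y, x < y → Prec (G x) (G y)) :
    ∃ (Q : CuPath S T) (e : IQ ≃o J), ∀ l, Q.f l = G (e l) := by
  obtain ⟨e⟩ := Order.iso_of_countable_dense IQ J
  exact ⟨⟨fun l => G (e l), fun l m h => hG _ _ (e.strictMono h)⟩, e, fun _ => rfl⟩

/-- An increasing sequence of paths has an upper bound `Q` every member of which is dominated by
some member of a path in the sequence. -/
theorem exists_diagonal [CuSemigroup S] (q : ℕ → CuPath S T)
    (hq : ∀ m n, m ≤ n → PathLE (q m) (q n)) :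
    ∃ Q : CuPath S T, (∀ n, PathLE (q n) Q) ∧ ∀ l, ∃ n m, Prec (Q.f l) ((q n).f m) := by
  obtain ⟨e, he⟩ := exists_surjective_nat IQ
  have hF : ∀ (k : ℕ) (m : IQ), ∃ m' : IQ, Prec ((q k).f m) ((q (k + 1)).f m') ∧
      Prec ((q k.unpair.1).f (e k.unpair.2)) ((q (k + 1)).f m') := by
    intro k m
    obtain ⟨m₁, h₁⟩ := hq k (k + 1) k.le_succ m
    obtain ⟨m₂, h₂⟩ := hq k.unpair.1 (k + 1) (k.unpair_left_le.trans k.le_succ) (e k.unpair.2)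
    obtain ⟨r, hr₁, hr₂⟩ := IQ.exists_gt₂ m₁ m₂
    exact ⟨r, h₁.trans ((q (k + 1)).prec _ _ hr₁), h₂.trans ((q (k + 1)).prec _ _ hr₂)⟩
  choose F hF₁ hF₂ using hF
  choose next hnext using IQ.exists_gt
  let μ : ℕ → IQ := fun k => Nat.rec (e 0) (fun k m => F k (next m)) k
  have hstep : ∀ k, Prec ((q k).f (next (μ k))) ((q (k + 1)).f (μ (k + 1))) := fun k => hF₁ _ _
  have hchain : ∀ k k', k < k' → Prec ((q k).f (next (μ k))) ((q k').f (μ k')) := by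
    intro k k' h
    induction k', h using Nat.le_induction with
    | base => exact hstep k
    | succ n _ ih => exact (ih.trans ((q n).prec _ _ (hnext _))).trans (hstep n)
  let φ : ℕ → IQ → IQ := fun k =>
    IQ.affine (μ k).1 (next (μ k)).1 (μ k).2.1.le (hnext _) (next (μ k)).2.2.le
  have hφ₁ : ∀ k l, (μ k).1 < (φ k l).1 := fun k l => IQ.lt_affine _ _ _ l
  have hφ₂ : ∀ k l, (φ k l).1 < (next (μ k)).1 := fun k l => IQ.affine_lt _ _ _ l
  have : Countable (ℕ ×ₗ IQ) := inferInstanceAs (Countable (ℕ × IQ))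
  have : Nonempty (ℕ ×ₗ IQ) := inferInstanceAs (Nonempty (ℕ × IQ))
  obtain ⟨Q, i, hQ⟩ := exists_reindex
    (fun x : ℕ ×ₗ IQ => (q (ofLex x).1).f (φ (ofLex x).1 (ofLex x).2)) (by
      intro x y hxy
      rcases Prod.Lex.lt_iff.1 hxy with h | ⟨h, h'⟩
      · exact (((q _).prec _ _ (hφ₂ _ _)).trans (hchain _ _ h)).trans ((q _).prec _ _ (hφ₁ _ _))
      · simp only [h]
        exact (q _).prec _ _ (IQ.affine_strictMono _ _ _ h'))
  refine ⟨Q, fun n l => ?_, fun l => ⟨(ofLex (i l)).1, next (μ (ofLex (i l)).1), ?_⟩⟩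
  · obtain ⟨j, rfl⟩ := he l
    have h := hF₂ (Nat.pair n j) (next (μ (Nat.pair n j)))
    rw [Nat.unpair_pair] at h
    refine ⟨i.symm (toLex (Nat.pair n j + 1, e 0)), ?_⟩
    rw [hQ, OrderIso.apply_symm_apply]
    exact h.trans ((q _).prec _ _ (hφ₁ (Nat.pair n j + 1) _))
  · rw [hQ]
    exact (q _).prec _ _ (hφ₂ _ _)

end CuPath

namespace BivCu

variable {S T : Type*} [AddCommMonoid S] [PartialOrder S] [AddCommMonoid T] [PartialOrder T]
  [CuSemigroup S]

theorem exists_mk (x : BivCu S T) : ∃ p, mk p = x := Quotient.exists_rep x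

theorem cut_wayBelow (p : CuPath S T) (l : IQ) : WayBelow (mk (p.cut_s10 l)) (mk p) := by
  intro c hc s hs hps
  choose q hq using fun n => exists_mk (c n)
  obtain ⟨Q, hQ, hQ'⟩ := CuPath.exists_diagonal q fun m n h => by
    rw [← mk_le_mk, hq, hq]
    exact hc h
  have hsQ : s ≤ mk Q := hs.2 (by
    rintro _ ⟨n, rfl⟩
    show c n ≤ mk Q
    rw [← hq n]
    exact hQ n)
  obtain ⟨m, hm⟩ := mk_le_mk.1 (hps.trans hsQ) l
  obtain ⟨n, k, hk⟩ := hQ' m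
  refine ⟨n, ?_⟩
  rw [← hq n]
  exact fun j => ⟨k, ((p.cut_prec_s10 l j).trans hm).trans hk⟩

theorem cut_mono (p : CuPath S T) {l m : IQ} (h : l ≤ m) : mk (p.cut_s10 l) ≤ mk (p.cut_s10 m) := by
  rcases h.eq_or_lt with rfl | h
  · exact le_rfl
  · intro j
    obtain ⟨k, hk⟩ := p.exists_cut_eq h
    exact ⟨k, hk ▸ p.cut_prec_s10 l j⟩

theorem exists_le_cut {x : BivCu S T} {p : CuPath S T} (h : WayBelow x (mk p)) :
    ∃ l, x ≤ mk (p.cut_s10 l) := by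
  obtain ⟨t, ht, hcof⟩ := IQ.exists_monotone_cofinal
  obtain ⟨n, hn⟩ := h (fun n => mk (p.cut_s10 (t n))) (fun _ _ h => cut_mono p (ht h)) (mk p)
    ⟨by
      rintro _ ⟨n, rfl⟩
      exact (cut_wayBelow p _).le, by
      intro z hz
      obtain ⟨q, rfl⟩ := exists_mk z
      intro l
      obtain ⟨m, hm⟩ := IQ.exists_gt l
      obtain ⟨n, hn⟩ := hcof m
      obtain ⟨k, hk⟩ := p.exists_cut_eq (hm.trans_le hn)
      rw [← hk]
      exact mk_le_mk.1 (hz ⟨n, rfl⟩) k⟩ le_rfl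
  exact ⟨t n, hn⟩

end BivCu

/-! ### Paths of elements -/

namespace ElemPath

section Preorder

variable {R : Type*} [Preorder R]

theorem monotone (g : ElemPath R) : Monotone g.f := fun _ _ h =>
  h.eq_or_lt.elim (fun h => h ▸ le_rfl) fun h => (g.prec _ _ h).le

/-- The part of a path strictly below the index `l`, reparametrized. -/
def cut_s10 (g : ElemPath R) (l : IQ) : ElemPath R where
  f m := g.f (IQ.affine 0 l.1 le_rfl l.2.1 l.2.2.le m)
  prec _ _ h := g.prec _ _ (IQ.affine_strictMono le_rfl l.2.1 l.2.2.le h)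

theorem cut_le (g : ElemPath R) (l m : IQ) : (g.cut_s10 l).f m ≤ g.f l :=
  (g.prec _ _ (IQ.affine_lt le_rfl l.2.1 l.2.2.le m)).le

theorem exists_cut_eq (g : ElemPath R) {l m : IQ} (h : m.1 < l.1) :
    ∃ k, (g.cut_s10 l).f k = g.f m := by
  obtain ⟨k, hk⟩ := IQ.exists_affine_eq le_rfl l.2.1 l.2.2.le m.2.1 h
  exact ⟨k, congrArg g.f hk⟩

theorem isLUB_comp_iff (g : ElemPath R) {t : ℕ → IQ} (ht : ∀ l, ∃ n, l ≤ t n) {r : R} :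
    IsLUB (Set.range fun n => g.f (t n)) r ↔ IsLUB (Set.range g.f) r := by
  have : upperBounds (Set.range fun n => g.f (t n)) = upperBounds (Set.range g.f) := by
    ext z
    constructor
    · rintro hz _ ⟨l, rfl⟩
      obtain ⟨n, hn⟩ := ht l
      exact (g.monotone hn).trans (hz ⟨n, rfl⟩)
    · rintro hz _ ⟨n, rfl⟩
      exact hz ⟨t n, rfl⟩
  rw [IsLUB, IsLUB, this]

/-- An element way below the endpoint of a path lies below a member of that path. -/
theorem exists_le_of_wayBelow {g : ElemPath R} {a r : R} (hg : IsLUB (Set.range g.f) r)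
    (h : WayBelow a r) : ∃ m, a ≤ g.f m := by
  obtain ⟨t, ht, hcof⟩ := IQ.exists_monotone_cofinal
  obtain ⟨n, hn⟩ := h (fun n => g.f (t n)) (fun _ _ h => g.monotone (ht h)) r
    ((g.isLUB_comp_iff hcof).2 hg) le_rfl
  exact ⟨t n, hn⟩

theorem wayBelow_endpoint {g : ElemPath R} {r : R} (hg : IsLUB (Set.range g.f) r) (l : IQ) :
    WayBelow (g.f l) r := by
  obtain ⟨m, hm⟩ := IQ.exists_gt l
  exact (g.prec l m hm).of_le_right (hg.1 ⟨m, rfl⟩)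

end Preorder

variable {R : Type*} [AddCommMonoid R] [PartialOrder R] [CuSemigroup R]

/-- Every element of a `Cu`-semigroup is the endpoint of a path. -/
theorem exists_isLUB (r : R) : ∃ g : ElemPath R, IsLUB (Set.range g.f) r := by
  obtain ⟨c, hc, hlub⟩ := CuSemigroup.O2 r
  have hinterp : ∀ a b : R, ∃ x, WayBelow a b → WayBelow a x ∧ WayBelow x b := fun a b => by
    by_cases h : WayBelow a b
    · obtain ⟨x, hx⟩ := exists_interpolate h
      exact ⟨x, fun _ => hx⟩
    · exact ⟨a, fun h' => absurd h' h⟩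
  choose mid hmid using hinterp
  -- `d n k` is the value of the path at the dyadic rational `k / 2 ^ n`
  let d : ℕ → ℕ → R := fun n => Nat.rec c
    (fun _ u k => if k % 2 = 0 then u (k / 2) else mid (u (k / 2)) (u (k / 2 + 1))) n
  have hd : ∀ n k, d (n + 1) k =
      if k % 2 = 0 then d n (k / 2) else mid (d n (k / 2)) (d n (k / 2 + 1)) := fun _ _ => rfl
  have hdbl : ∀ n k, d (n + 1) (2 * k) = d n k := fun n k => by
    rw [hd, if_pos (by omega), Nat.mul_div_cancel_left _ two_pos]
  have hstep : ∀ n k, WayBelow (d n k) (d n (k + 1)) := by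
    intro n
    induction n with
    | zero => exact hc
    | succ n ih =>
      intro k
      have h := hmid _ _ (ih (k / 2))
      rcases Nat.mod_two_eq_zero_or_one k with hk | hk
      · rw [hd, hd, if_pos hk, if_neg (by omega), show (k + 1) / 2 = k / 2 by omega]
        exact h.1
      · rw [hd, hd, if_neg (by omega), if_pos (by omega), show (k + 1) / 2 = k / 2 + 1 by omega]
        exact h.2
  have hmono : ∀ n, Monotone (d n) := fun n => monotone_nat_of_le_succ fun k => (hstep n k).le
  let u : ℚ → ℕ → R := fun x n => d n (⌈2 ^ n * x⌉₊ - 1)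
  have hu : ∀ x : ℚ, 0 < x → Monotone (u x) := fun x hx => by
    refine monotone_nat_of_le_succ fun n => ?_
    show d n (⌈2 ^ n * x⌉₊ - 1) ≤ d (n + 1) (⌈2 ^ (n + 1) * x⌉₊ - 1)
    rw [← hdbl]
    refine hmono (n + 1) ?_
    have h0 : 0 < ⌈2 ^ n * x⌉₊ := Nat.ceil_pos.2 (by positivity)
    have h1 : ⌈2 ^ n * x⌉₊ - 1 < 2 ^ n * x := by
      have := Nat.ceil_lt_add_one (a := 2 ^ n * x) (by positivity)
      linarith
    have h2 := Nat.le_ceil (2 ^ (n + 1) * x)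
    have h3 : 2 * ⌈2 ^ n * x⌉₊ < ⌈2 ^ (n + 1) * x⌉₊ + 2 := by
      have : (2 * ⌈2 ^ n * x⌉₊ : ℚ) < ⌈2 ^ (n + 1) * x⌉₊ + 2 := by
        rw [pow_succ'] at h2 ⊢
        linarith
      exact_mod_cast this
    omega
  choose f hf using fun x : Set.Ioi (0 : ℚ) => CuSemigroup.O1 (u x.1) (hu x.1 x.2)
  have hlow : ∀ (x : Set.Ioi (0 : ℚ)) (n k : ℕ), (k : ℚ) < 2 ^ n * x.1 → d n k ≤ f x := by
    intro x n k h
    refine le_trans (hmono n ?_) ((hf x).1 ⟨n, rfl⟩)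
    have := Nat.lt_ceil.2 h
    omega
  have hupp : ∀ (x : Set.Ioi (0 : ℚ)) (n k : ℕ), 2 ^ n * x.1 ≤ k → f x ≤ d n k := by
    intro x n k h
    refine (hf x).2 ?_
    rintro _ ⟨j, rfl⟩
    refine (hu x.1 x.2 (Nat.le_add_left j n)).trans ?_
    have hpow' : ∀ i, d (n + i) (2 ^ i * k) = d n k := by
      intro i
      induction i with
      | zero => rw [pow_zero, one_mul, add_zero]
      | succ i ih => rw [← add_assoc, pow_succ', mul_assoc, hdbl, ih]
    rw [← hpow' j]
    refine hmono _ ((Nat.sub_le _ _).trans (Nat.ceil_le.2 ?_))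
    push_cast
    rw [pow_add, mul_comm (2 ^ n) (2 ^ j : ℚ), mul_assoc]
    exact mul_le_mul_of_nonneg_left h (by positivity)
  have hway : ∀ x y : Set.Ioi (0 : ℚ), x < y → WayBelow (f x) (f y) := by
    intro x y hxy
    have hxy' : 0 < y.1 - x.1 := sub_pos.2 hxy
    obtain ⟨n, hn⟩ := pow_unbounded_of_one_lt (2 / (y.1 - x.1)) (one_lt_two (α := ℚ))
    rw [div_lt_iff₀ hxy'] at hn
    have h0 : (0 : ℚ) ≤ 2 ^ n * x.1 := mul_nonneg (by positivity) x.2.le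
    have h1 := Nat.ceil_lt_add_one h0
    refine ((hstep n _).of_le_left (hupp x n _ (Nat.le_ceil _))).of_le_right (hlow y n _ ?_)
    push_cast
    linarith
  obtain ⟨e⟩ := Order.iso_of_countable_dense IQ (Set.Ioi (0 : ℚ))
  refine ⟨⟨fun l => f (e l), fun l m h => hway _ _ (e.strictMono h)⟩, ?_, fun z hz => ?_⟩
  · rintro _ ⟨l, rfl⟩
    obtain ⟨k, hk⟩ := exists_nat_ge (e l).1
    exact (hupp (e l) 0 k (by simpa using hk)).trans (hlub.1 ⟨k, rfl⟩)
  · refine hlub.2 ?_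
    rintro _ ⟨k, rfl⟩
    let x : Set.Ioi (0 : ℚ) := ⟨(k + 1 : ℕ), Set.mem_Ioi.2 (by positivity)⟩
    refine le_trans (hlow x 0 k ?_) (hz ⟨e.symm x, congrArg f (e.apply_symm_apply x)⟩)
    show (k : ℚ) < 2 ^ 0 * ((k + 1 : ℕ) : ℚ)
    push_cast
    linarith

/-- A chosen path with endpoint `r`. -/
noncomputable def ofEndpoint (r : R) : ElemPath R := (exists_isLUB r).choose

theorem isLUB_ofEndpoint (r : R) : IsLUB (Set.range (ofEndpoint r).f) r :=
  (exists_isLUB r).choose_spec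

end ElemPath

/-! ### Scaling by a bimorphism -/

theorem IsCuBimor.isLUB_elemPath {A B C : Type*} [AddCommMonoid A] [PartialOrder A]
    [AddCommMonoid B] [PartialOrder B] [AddCommMonoid C] [PartialOrder C] {φ : A → B → C}
    (hφ : IsCuBimor φ) {g : ElemPath A} {h : ElemPath B} {k : ElemPath C}
    (hk : ∀ l, k.f l = φ (g.f l) (h.f l)) {a : A} {b : B}
    (ha : IsLUB (Set.range g.f) a) (hb : IsLUB (Set.range h.f) b) :
    IsLUB (Set.range k.f) (φ a b) := by
  obtain ⟨-, -, -, -, -, -, hsup, -⟩ := hφ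
  obtain ⟨t, ht, hcof⟩ := IQ.exists_monotone_cofinal
  rw [← k.isLUB_comp_iff hcof]
  simp only [hk]
  exact hsup _ _ _ _ (fun _ _ h => g.monotone (ht h)) (fun _ _ h' => h.monotone (ht h'))
    ((g.isLUB_comp_iff hcof).2 ha) ((h.isLUB_comp_iff hcof).2 hb)

section Scale

variable {R S T : Type*} [AddCommMonoid R] [PartialOrder R]
  [AddCommMonoid S] [PartialOrder S] [AddCommMonoid T] [PartialOrder T] {act : R → T → T}

/-- Left multiplication by `r` as a generalized Cu-morphism. -/
def GenCuMor.ofAct (hact : IsCuBimor act) (r : R) : GenCuMor T T where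
  toFun := act r
  map_zero' := hact.2.1 r
  map_add' := hact.2.2.2.1 r
  mono' := fun b b' h => hact.2.2.2.2.2.1 r b b' h
  map_sup' := fun c s hc hs =>
    hact.2.2.2.2.2.2.1 (fun _ => r) c r s monotone_const hc
      (by rw [Set.range_const]; exact isLUB_singleton) hs

theorem Prec.ofAct (hact : IsCuBimor act) {r' r : R} (h : WayBelow r' r) :
    Prec (GenCuMor.ofAct hact r') (GenCuMor.ofAct hact r) :=
  fun a' a ha => hact.2.2.2.2.2.2.2 r' r a' a h ha

/-- The pointwise product of a path of elements and a path of generalized Cu-morphisms. -/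
def CuPath.scale (hact : IsCuBimor act) (g : ElemPath R) (p : CuPath S T) : CuPath S T where
  f l := (GenCuMor.ofAct hact (g.f l)).comp (p.f l)
  prec l m h := (p.prec l m h).comp (Prec.ofAct hact (g.prec l m h))

theorem CuPath.eq_scale (hact : IsCuBimor act) {g : ElemPath R} {p P : CuPath S T}
    (h : ∀ (l : IQ) (a : S), (P.f l).toFun a = act (g.f l) ((p.f l).toFun a)) :
    P = CuPath.scale hact g p :=
  CuPath.ext' (funext fun l => GenCuMor.ext' (funext fun a => h l a))

theorem CuPath.scale_cut (hact : IsCuBimor act) (g : ElemPath R) (p : CuPath S T) (l : IQ) :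
    (CuPath.scale hact g p).cut_s10 l = CuPath.scale hact (g.cut_s10 l) (p.cut_s10 l) := rfl

theorem PathLE.scale [CuSemigroup S] (hact : IsCuBimor act) {g g' : ElemPath R}
    {p p' : CuPath S T} (hg : ∀ l, ∃ m, g.f l ≤ g'.f m) (hp : PathLE p p') :
    PathLE (CuPath.scale hact g p) (CuPath.scale hact g' p') := by
  intro l
  obtain ⟨m₁, h₁⟩ := hp l
  obtain ⟨m₂, h₂⟩ := hg l
  obtain ⟨r, hr₁, hr₂⟩ := IQ.exists_gt₂ m₁ m₂
  exact ⟨r, (h₁.trans (p'.prec _ _ hr₁)).comp (Prec.ofAct hact ((g'.prec _ _ hr₂).of_le_left h₂))⟩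

namespace BivCu

variable [CuSemigroup S] (hact : IsCuBimor act)

theorem mk_scale_le {g g' : ElemPath R} {p p' : CuPath S T}
    (hg : ∀ l, ∃ m, g.f l ≤ g'.f m) (hp : mk p ≤ mk p') :
    mk (CuPath.scale hact g p) ≤ mk (CuPath.scale hact g' p') :=
  PathLE.scale hact hg hp

theorem mk_scale_le_of_endpoint_le {r r' : R} {g g' : ElemPath R} {p p' : CuPath S T}
    (hg : IsLUB (Set.range g.f) r) (hg' : IsLUB (Set.range g'.f) r') (hr : r ≤ r')
    (hp : mk p ≤ mk p') : mk (CuPath.scale hact g p) ≤ mk (CuPath.scale hact g' p') :=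
  mk_scale_le hact (fun l => ElemPath.exists_le_of_wayBelow hg'
    ((ElemPath.wayBelow_endpoint hg l).of_le_right hr)) hp

theorem mk_scale_eq {r : R} {g g' : ElemPath R} {p p' : CuPath S T}
    (hg : IsLUB (Set.range g.f) r) (hg' : IsLUB (Set.range g'.f) r) (hp : mk p = mk p') :
    mk (CuPath.scale hact g p) = mk (CuPath.scale hact g' p') :=
  le_antisymm (mk_scale_le_of_endpoint_le hact hg hg' le_rfl hp.le)
    (mk_scale_le_of_endpoint_le hact hg' hg le_rfl hp.ge)

variable [CuSemigroup R]

/-- The action on `⟦S,T⟧` induced by an action on `T`. -/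
noncomputable def smul (r : R) (x : BivCu S T) : BivCu S T :=
  mk (CuPath.scale hact (ElemPath.ofEndpoint r) (Quotient.out x))

theorem smul_mk {r : R} {g : ElemPath R} (hg : IsLUB (Set.range g.f) r) (p : CuPath S T) :
    smul hact r (mk p) = mk (CuPath.scale hact g p) :=
  mk_scale_eq hact (ElemPath.isLUB_ofEndpoint r) hg (Quotient.out_eq (mk p))

theorem smul_le_smul {r r' : R} {x x' : BivCu S T} (hr : r ≤ r') (hx : x ≤ x') :
    smul hact r x ≤ smul hact r' x' := by
  obtain ⟨p, rfl⟩ := exists_mk x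
  obtain ⟨p', rfl⟩ := exists_mk x'
  rw [smul_mk hact (ElemPath.isLUB_ofEndpoint r), smul_mk hact (ElemPath.isLUB_ofEndpoint r')]
  exact mk_scale_le_of_endpoint_le hact (ElemPath.isLUB_ofEndpoint r)
    (ElemPath.isLUB_ofEndpoint r') hr hx

theorem mk_scale_le_smul {g : ElemPath R} {p : CuPath S T} {r : R} {x : BivCu S T}
    (hg : ∀ l, g.f l ≤ r) (hp : mk p ≤ x) : mk (CuPath.scale hact g p) ≤ smul hact r x := by
  obtain ⟨p', rfl⟩ := exists_mk x
  rw [smul_mk hact (ElemPath.isLUB_ofEndpoint r)]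
  refine mk_scale_le hact (fun l => ?_) hp
  obtain ⟨m, hm⟩ := IQ.exists_gt l
  exact ElemPath.exists_le_of_wayBelow (ElemPath.isLUB_ofEndpoint r)
    ((g.prec l m hm).of_le_right (hg m))

theorem isLUB_smul {c : ℕ → R} {d : ℕ → BivCu S T} {s : R} {t : BivCu S T} (hc : Monotone c)
    (hd : Monotone d) (hs : IsLUB (Set.range c) s) (ht : IsLUB (Set.range d) t) :
    IsLUB (Set.range fun n => smul hact (c n) (d n)) (smul hact s t) := by
  refine ⟨?_, fun z hz => ?_⟩
  · rintro _ ⟨n, rfl⟩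
    exact smul_le_smul hact (hs.1 ⟨n, rfl⟩) (ht.1 ⟨n, rfl⟩)
  obtain ⟨p, rfl⟩ := exists_mk t
  obtain ⟨q, rfl⟩ := exists_mk z
  have hg := ElemPath.isLUB_ofEndpoint s
  rw [smul_mk hact hg]
  intro l
  obtain ⟨l', hl⟩ := IQ.exists_gt l
  obtain ⟨m, hm⟩ := ElemPath.wayBelow_endpoint hg l' c hc s hs le_rfl
  obtain ⟨n, hn⟩ := cut_wayBelow p l' d hd (mk p) ht le_rfl
  have hle : mk ((CuPath.scale hact (ElemPath.ofEndpoint s) p).cut_s10 l') ≤ mk q := by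
    rw [CuPath.scale_cut]
    refine (mk_scale_le_smul hact (r := c (max m n)) (x := d (max m n)) (fun k => ?_) ?_).trans
      (hz ⟨max m n, rfl⟩)
    · exact (ElemPath.cut_le _ l' k).trans (hm.trans (hc (le_max_left m n)))
    · exact hn.trans (hd (le_max_right m n))
  obtain ⟨k, hk⟩ := CuPath.exists_cut_eq (CuPath.scale hact (ElemPath.ofEndpoint s) p) hl
  rw [← hk]
  exact mk_le_mk.1 hle k

theorem smul_wayBelow_smul {r' r : R} {x' x : BivCu S T} (hr : WayBelow r' r)
    (hx : WayBelow x' x) : WayBelow (smul hact r' x') (smul hact r x) := by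
  obtain ⟨p, rfl⟩ := exists_mk x
  have hg := ElemPath.isLUB_ofEndpoint r
  have hg' := ElemPath.isLUB_ofEndpoint r'
  obtain ⟨l, hl⟩ := exists_le_cut hx
  obtain ⟨m, hm⟩ := ElemPath.exists_le_of_wayBelow hg hr
  obtain ⟨k, hk₁, hk₂⟩ := IQ.exists_gt₂ l m
  rw [smul_mk hact hg]
  refine (cut_wayBelow (CuPath.scale hact (ElemPath.ofEndpoint r) p) k).of_le_left ?_
  obtain ⟨q, rfl⟩ := exists_mk x'
  rw [smul_mk hact hg', CuPath.scale_cut]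
  obtain ⟨j, hj⟩ := (ElemPath.ofEndpoint r).exists_cut_eq hk₂
  exact mk_scale_le hact (fun i => ⟨j, hj ▸ (hg'.1 ⟨i, rfl⟩).trans hm⟩)
    (hl.trans (cut_mono p (le_of_lt hk₁)))

theorem zero_smul [CuSemigroup T] (x : BivCu S T) : smul hact 0 x = 0 := by
  obtain ⟨p, rfl⟩ := exists_mk x
  rw [smul_mk hact (g := ⟨fun _ => 0, fun _ _ _ => wayBelow_zero⟩)
    (by rw [Set.range_const]; exact isLUB_singleton)]
  exact congrArg mk (CuPath.ext' (funext fun l => GenCuMor.ext' (funext fun a => hact.1 _)))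

theorem smul_zero [CuSemigroup T] (r : R) : smul hact r (0 : BivCu S T) = 0 := by
  show smul hact r (mk (CuPath.zero S T)) = mk (CuPath.zero S T)
  rw [smul_mk hact (ElemPath.isLUB_ofEndpoint r)]
  exact congrArg mk (CuPath.ext' (funext fun l => GenCuMor.ext' (funext fun a => hact.2.1 _)))

theorem add_smul [CuSemigroup T] (r r' : R) (x : BivCu S T) :
    smul hact (r + r') x = smul hact r x + smul hact r' x := by
  obtain ⟨p, rfl⟩ := exists_mk x
  have hg := ElemPath.isLUB_ofEndpoint r
  have hg' := ElemPath.isLUB_ofEndpoint r'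
  let k : ElemPath R := ⟨fun l => (ElemPath.ofEndpoint r).f l + (ElemPath.ofEndpoint r').f l,
    fun l m h => CuSemigroup.O3 _ _ _ _ (ElemPath.prec _ l m h) (ElemPath.prec _ l m h)⟩
  have hk : IsLUB (Set.range k.f) (r + r') := by
    obtain ⟨t, ht, hcof⟩ := IQ.exists_monotone_cofinal
    rw [← k.isLUB_comp_iff hcof]
    exact CuSemigroup.O4 _ _ _ _ (fun _ _ h => ElemPath.monotone _ (ht h))
      (fun _ _ h => ElemPath.monotone _ (ht h)) ((ElemPath.isLUB_comp_iff _ hcof).2 hg)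
      ((ElemPath.isLUB_comp_iff _ hcof).2 hg')
  rw [smul_mk hact hg, smul_mk hact hg', smul_mk hact hk, mk_add_mk]
  exact congrArg mk (CuPath.ext' (funext fun l => GenCuMor.ext' (funext fun a =>
    hact.2.2.1 _ _ _)))

theorem smul_add [CuSemigroup T] (r : R) (x y : BivCu S T) :
    smul hact r (x + y) = smul hact r x + smul hact r y := by
  obtain ⟨p, rfl⟩ := exists_mk x
  obtain ⟨q, rfl⟩ := exists_mk y
  have hg := ElemPath.isLUB_ofEndpoint r
  rw [mk_add_mk, smul_mk hact hg, smul_mk hact hg, smul_mk hact hg, mk_add_mk]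
  exact congrArg mk (CuPath.ext' (funext fun l => GenCuMor.ext' (funext fun a =>
    hact.2.2.2.1 _ _ _)))

theorem isCuBimor_smul [CuSemigroup T] :
    IsCuBimor (smul hact : R → BivCu S T → BivCu S T) :=
  ⟨zero_smul hact, smul_zero hact, add_smul hact, smul_add hact,
    fun _ _ _ h => smul_le_smul hact h le_rfl, fun _ _ _ h => smul_le_smul hact le_rfl h,
    fun _ _ _ _ hc hd hs ht => isLUB_smul hact hc hd hs ht,
    fun _ _ _ _ hr hx => smul_wayBelow_smul hact hr hx⟩

theorem mul_smul {mul : R → R → R} (hmul : IsCuBimor mul)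
    (hassoc : ∀ (r r' : R) (b : T), act (mul r r') b = act r (act r' b))
    (r r' : R) (x : BivCu S T) : smul hact (mul r r') x = smul hact r (smul hact r' x) := by
  obtain ⟨p, rfl⟩ := exists_mk x
  have hg := ElemPath.isLUB_ofEndpoint r
  have hg' := ElemPath.isLUB_ofEndpoint r'
  let k : ElemPath R := ⟨fun l => mul ((ElemPath.ofEndpoint r).f l) ((ElemPath.ofEndpoint r').f l),
    fun l m h => hmul.2.2.2.2.2.2.2 _ _ _ _ (ElemPath.prec _ l m h) (ElemPath.prec _ l m h)⟩
  have hk : IsLUB (Set.range k.f) (mul r r') := hmul.isLUB_elemPath (fun _ => rfl) hg hg'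
  rw [smul_mk hact hg', smul_mk hact hg, smul_mk hact hk]
  exact congrArg mk (CuPath.ext' (funext fun l => GenCuMor.ext' (funext fun a =>
    hassoc _ _ _)))

theorem one_smul {one : R} (hone : WayBelow one one) (hact_one : ∀ b : T, act one b = b)
    (x : BivCu S T) : smul hact one x = x := by
  obtain ⟨p, rfl⟩ := exists_mk x
  rw [smul_mk hact (g := ⟨fun _ => one, fun _ _ _ => hone⟩)
    (by rw [Set.range_const]; exact isLUB_singleton)]
  exact congrArg mk (CuPath.ext' (funext fun l => GenCuMor.ext' (funext fun a => hact_one _)))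

end BivCu

end Scale

/-- Let `R` be a Cu-semiring with compact unit and let `T` carry a left
`R`-action. For `r ∈ R` and `x ∈ ⟦S,T⟧`, scaling a representing path of `x` by a path in
`(R,≪)` with endpoint `r` yields a path whose class depends only on `r` and `x`, and the
induced assignment is a left `R`-action on `⟦S,T⟧`. -/
theorem induced_action_on_bivariant
    (R S T : Type*) [AddCommMonoid R] [PartialOrder R] [CuSemigroup R]
    [AddCommMonoid S] [PartialOrder S] [CuSemigroup S]
    [AddCommMonoid T] [PartialOrder T] [CuSemigroup T]
    (mul : R → R → R) (one : R) (hbi : IsCuBimor mul)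
    (hassoc : ∀ a b c : R, mul (mul a b) c = mul a (mul b c))
    (hone : ∀ a : R, mul a one = a) (hone' : ∀ a : R, mul one a = a)
    (hcompact : WayBelow one one)
    (act : R → T → T) (hact : IsCuBimor act)
    (hact_assoc : ∀ (r r' : R) (b : T), act (mul r r') b = act r (act r' b))
    (hact_one : ∀ b : T, act one b = b) :
    (∀ (g : ElemPath R) (p : CuPath S T),
      ∃ P : CuPath S T, ∀ (l : IQ) (a : S), (P.f l).toFun a = act (g.f l) ((p.f l).toFun a)) ∧
    (∀ (r : R) (g g' : ElemPath R) (p p' P P' : CuPath S T),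
      IsLUB (Set.range g.f) r → IsLUB (Set.range g'.f) r →
      (∀ (l : IQ) (a : S), (P.f l).toFun a = act (g.f l) ((p.f l).toFun a)) →
      (∀ (l : IQ) (a : S), (P'.f l).toFun a = act (g'.f l) ((p'.f l).toFun a)) →
      BivCu.mk p = BivCu.mk p' → BivCu.mk P = BivCu.mk P') ∧
    (∃ smul : R → BivCu S T → BivCu S T,
      (∀ (r : R) (g : ElemPath R) (p P : CuPath S T), IsLUB (Set.range g.f) r →
        (∀ (l : IQ) (a : S), (P.f l).toFun a = act (g.f l) ((p.f l).toFun a)) →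
        smul r (BivCu.mk p) = BivCu.mk P) ∧
      IsCuBimor smul ∧
      (∀ (r r' : R) (x : BivCu S T), smul (mul r r') x = smul r (smul r' x)) ∧
      (∀ x : BivCu S T, smul one x = x)) := by
  refine ⟨fun g p => ⟨CuPath.scale hact g p, fun _ _ => rfl⟩, ?_,
    BivCu.smul hact, ?_, BivCu.isCuBimor_smul hact, BivCu.mul_smul hact hbi hact_assoc,
    BivCu.one_smul hact hcompact hact_one⟩
  · intro r g g' p p' P P' hg hg' hP hP' h
    rw [CuPath.eq_scale hact hP, CuPath.eq_scale hact hP']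
    exact BivCu.mk_scale_eq hact hg hg' h
  · intro r g p P hg hP
    rw [CuPath.eq_scale hact hP]
    exact BivCu.smul_mk hact hg p
end

section
/- Let S and T be Cu-semigroups. Then the composition product makes ⟦S,T⟧ a left Cu-semimodule over the Cu-semiring ⟦T,T⟧ and a right Cu-semimodule over the Cu-semiring ⟦S,S⟧, and these two actions are compatible: y∘(x∘z) = (y∘x)∘z for all y ∈ ⟦T,T⟧, x ∈ ⟦S,T⟧ and z ∈ ⟦S,S⟧. Thus ⟦S,T⟧ is a (⟦T,T⟧, ⟦S,S⟧)-Cu-semibimodule. -/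
namespace IQ

/-- The points `1 - 1 / (n + 2)`, which are cofinal in `ℚ ∩ (0,1)`. -/
def grid (n : ℕ) : IQ :=
  ⟨1 - 1 / ((n : ℚ) + 2), by
    have h : 1 / ((n : ℚ) + 2) < 1 := by
      rw [div_lt_one (by positivity)]
      linarith [n.cast_nonneg (α := ℚ)]
    have h' : 0 < 1 / ((n : ℚ) + 2) := by positivity
    constructor <;> linarith⟩

theorem grid_mono {m n : ℕ} (h : m ≤ n) : (grid m).1 ≤ (grid n).1 := by
  have h' : (m : ℚ) ≤ n := by exact_mod_cast h
  have : 1 / ((n : ℚ) + 2) ≤ 1 / ((m : ℚ) + 2) :=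
    one_div_le_one_div_of_le (by positivity) (by linarith)
  simp only [grid]
  linarith

theorem exists_lt_grid (l : IQ) : ∃ n, l.1 < (grid n).1 := by
  have hl : 0 < 1 - l.1 := by linarith [l.2.2]
  obtain ⟨n, hn⟩ := exists_nat_gt (1 / (1 - l.1))
  refine ⟨n, ?_⟩
  have : 1 / ((n : ℚ) + 2) < 1 - l.1 := by
    rw [div_lt_iff₀ hl] at hn
    rw [div_lt_iff₀ (by positivity)]
    nlinarith
  simp only [grid]
  linarith

/-- The product of two points of `ℚ ∩ (0,1)`. -/
def mul (l m : IQ) : IQ :=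
  ⟨l.1 * m.1, mul_pos l.2.1 m.2.1, mul_lt_one_of_nonneg_of_lt_one_left l.2.1.le l.2.2 m.2.2.le⟩

/-- The point at relative position `(1 + t) / 4` between `a` and `1`. -/
def between (a : IQ) (t : ℚ) (ht : 0 ≤ t ∧ t < 1) : IQ :=
  ⟨a.1 + (1 - a.1) / 4 * (1 + t), by
    have h0 := a.2.1
    have h1 : 0 < 1 - a.1 := by linarith [a.2.2]
    constructor
    · have := ht.1
      positivity
    · nlinarith [ht.2]⟩

/-- The midpoint of `a` and `1`. -/
def up (a : IQ) : IQ :=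
  ⟨(a.1 + 1) / 2, by linarith [a.2.1], by linarith [a.2.2]⟩

theorem lt_between (a : IQ) (t : ℚ) (ht : 0 ≤ t ∧ t < 1) : a.1 < (between a t ht).1 := by
  have h1 : 0 < 1 - a.1 := by linarith [a.2.2]
  have : 0 < (1 - a.1) / 4 * (1 + t) := by
    have := ht.1
    positivity
  simp only [between]
  linarith

theorem between_lt_up (a : IQ) (t : ℚ) (ht : 0 ≤ t ∧ t < 1) :
    (between a t ht).1 < (up a).1 := by
  have h1 : 0 < 1 - a.1 := by linarith [a.2.2]
  simp only [between, up]
  nlinarith [ht.2]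

theorem between_lt_between (a : IQ) {t t' : ℚ} (ht : 0 ≤ t ∧ t < 1) (ht' : 0 ≤ t' ∧ t' < 1)
    (h : t < t') : (between a t ht).1 < (between a t' ht').1 := by
  have h1 : 0 < 1 - a.1 := by linarith [a.2.2]
  simp only [between]
  nlinarith

/-- A strictly increasing reparametrization of `ℚ ∩ (0,1)` by `ℚ ∩ (1,∞)`. -/
def scale (l : IQ) : ℚ := 1 / (1 - l.1)

theorem scale_nonneg (l : IQ) : 0 ≤ scale l :=
  one_div_nonneg.mpr (by linarith [l.2.2])

theorem scale_lt_scale {l m : IQ} (h : l.1 < m.1) : scale l < scale m :=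
  one_div_lt_one_div_of_lt (by linarith [m.2.2]) (by linarith)

theorem floor_scale_grid (n : ℕ) : ⌊scale (grid n)⌋₊ = n + 2 := by
  have : scale (grid n) = ((n + 2 : ℕ) : ℚ) := by
    simp [scale, grid]
  rw [this, Nat.floor_natCast]

theorem scale_sub_floor (l : IQ) : 0 ≤ scale l - ⌊scale l⌋₊ ∧ scale l - ⌊scale l⌋₊ < 1 :=
  ⟨by linarith [Nat.floor_le (scale_nonneg l)], by linarith [Nat.lt_floor_add_one (scale l)]⟩

end IQ

section Sup

variable {S T : Type*} [AddCommMonoid S] [PartialOrder S] [AddCommMonoid T] [PartialOrder T]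
  [CuSemigroup S]

/-- Finitely many morphisms dominated by a path are dominated by one member of it. -/
theorem CuPath.exists_prec_forall_lt (q : CuPath S T) (g : ℕ → GenCuMor S T) (N : ℕ)
    (h : ∀ n < N, ∃ m, Prec (g n) (q.f m)) : ∃ m, ∀ n < N, Prec (g n) (q.f m) := by
  induction N with
  | zero => exact ⟨IQ.grid 0, fun n hn => absurd hn n.not_lt_zero⟩
  | succ N ih =>
    obtain ⟨m₁, h₁⟩ := ih fun n hn => h n (by omega)
    obtain ⟨m₂, h₂⟩ := h N (by omega)
    obtain ⟨r, hr₁, hr₂⟩ := IQ.exists_gt₂ m₁ m₂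
    refine ⟨r, fun n hn => ?_⟩
    rcases Nat.lt_succ_iff_lt_or_eq.mp hn with hn | rfl
    · exact (h₁ n hn).trans (q.prec _ _ hr₁)
    · exact h₂.trans (q.prec _ _ hr₂)

/-- An increasing sequence of paths has an upper bound each of whose members is dominated by a
member of one of the given paths. -/
theorem CuPath.exists_sup (p : ℕ → CuPath S T) (hp : ∀ m n, m ≤ n → PathLE (p m) (p n)) :
    ∃ u : CuPath S T, (∀ n, PathLE (p n) u) ∧ ∀ l, ∃ n m, Prec (u.f l) ((p n).f m) := by
  have step : ∀ (k : ℕ) (a : IQ), ∃ a' : IQ, Prec ((p k).f a.up) ((p (k + 1)).f a') ∧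
      ∀ n < k + 1, Prec ((p n).f (IQ.grid k)) ((p (k + 1)).f a') := by
    intro k a
    obtain ⟨m₁, h₁⟩ := hp k (k + 1) (by omega) a.up
    obtain ⟨m₂, h₂⟩ := (p (k + 1)).exists_prec_forall_lt (fun n => (p n).f (IQ.grid k)) (k + 1)
      fun n hn => hp n (k + 1) hn.le _
    obtain ⟨r, hr₁, hr₂⟩ := IQ.exists_gt₂ m₁ m₂
    exact ⟨r, h₁.trans ((p (k + 1)).prec _ _ hr₁),
      fun n hn => (h₂ n hn).trans ((p (k + 1)).prec _ _ hr₂)⟩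
  choose next hnext hgrid using step
  let a : ℕ → IQ := fun n => Nat.rec (IQ.grid 0) next n
  have ha : ∀ k, Prec ((p k).f (a k).up) ((p (k + 1)).f (a (k + 1))) := fun k => hnext k (a k)
  have hag : ∀ k, ∀ n < k + 1, Prec ((p n).f (IQ.grid k)) ((p (k + 1)).f (a (k + 1))) :=
    fun k => hgrid k (a k)
  have hup : ∀ k, Prec ((p k).f (a k)) ((p k).f (a k).up) := fun k =>
    (p k).prec _ _ (by simp only [IQ.up]; linarith [(a k).2.2])
  have hchain : ∀ j k, j < k → Prec ((p j).f (a j).up) ((p k).f (a k)) := by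
    intro j k hjk
    induction k, hjk using Nat.le_induction with
    | base => exact ha j
    | succ k _ ih => exact (ih.trans (hup k)).trans (ha k)
  let u : CuPath S T :=
    { f := fun l => (p ⌊l.scale⌋₊).f ((a ⌊l.scale⌋₊).between _ l.scale_sub_floor)
      prec := by
        intro l m hlm
        have hs := IQ.scale_lt_scale hlm
        rcases (Nat.floor_mono hs.le).eq_or_lt with h | h
        · have : ∀ (k : ℕ) (t : ℚ) (ht : 0 ≤ t ∧ t < 1), k = ⌊l.scale⌋₊ →
              l.scale - ⌊l.scale⌋₊ < t →
              Prec ((p ⌊l.scale⌋₊).f ((a ⌊l.scale⌋₊).between _ l.scale_sub_floor))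
                ((p k).f ((a k).between t ht)) := by
            rintro _ t ht rfl hlt
            exact (p _).prec _ _ (IQ.between_lt_between _ _ _ hlt)
          exact this _ _ _ h.symm (by rw [h]; linarith)
        · exact (((p _).prec _ _ (IQ.between_lt_up _ _ _)).trans (hchain _ _ h)).trans
            ((p _).prec _ _ (IQ.lt_between _ _ _)) }
  refine ⟨u, fun n l => ?_, fun l => ?_⟩
  · obtain ⟨k, hk⟩ := l.exists_lt_grid
    refine ⟨IQ.grid (max n k), ?_⟩
    have h₁ : Prec ((p n).f l) ((p n).f (IQ.grid (max n k + 1))) :=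
      (p n).prec _ _ (hk.trans_le (IQ.grid_mono (by omega)))
    have h₂ := hag (max n k + 1) n (by omega)
    have h₃ : Prec ((p (max n k + 2)).f (a (max n k + 2))) (u.f (IQ.grid (max n k))) := by
      have : ∀ (j : ℕ) (t : ℚ) (ht : 0 ≤ t ∧ t < 1), j = max n k + 2 →
          Prec ((p (max n k + 2)).f (a (max n k + 2))) ((p j).f ((a j).between t ht)) := by
        rintro _ t ht rfl
        exact (p _).prec _ _ (IQ.lt_between _ _ _)
      exact this _ _ _ (IQ.floor_scale_grid _)
    exact (h₁.trans h₂).trans h₃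
  · obtain ⟨m, hm⟩ := IQ.exists_gt ((a ⌊l.scale⌋₊).between _ l.scale_sub_floor)
    exact ⟨_, m, (p _).prec _ _ hm⟩

namespace BivCu

theorem mk_surjective : Function.Surjective (mk : CuPath S T → BivCu S T) :=
  Quotient.exists_rep

theorem comp_id (x : BivCu S T) : comp x (id S) = x := by
  obtain ⟨x, rfl⟩ := mk_surjective x
  rfl

/-- Members of a path representing a supremum are dominated by members of the sequence. -/
theorem exists_prec_of_isLUB {p : ℕ → CuPath S T} {q : CuPath S T}
    (hp : Monotone fun n => mk (p n)) (hq : IsLUB (Set.range fun n => mk (p n)) (mk q)) (l : IQ) :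
    ∃ n m, Prec (q.f l) ((p n).f m) := by
  obtain ⟨u, hu, hu'⟩ := CuPath.exists_sup p fun m n h => hp h
  have hle : mk q ≤ mk u := hq.2 (by rintro _ ⟨n, rfl⟩; exact hu n)
  obtain ⟨m, hm⟩ := hle l
  obtain ⟨n, r, hr⟩ := hu' m
  exact ⟨n, r, hm.trans hr⟩

/-- A class way-below `[q]` is dominated by a single member of the path `q`. -/
theorem exists_forall_prec_of_wayBelow {p q : CuPath S T} (h : WayBelow (mk p) (mk q)) :
    ∃ m, ∀ l, Prec (p.f l) (q.f m) := by
  let cut : ℕ → CuPath S T := fun n =>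
    { f := fun l => q.f ((IQ.grid n).mul l)
      prec := fun l m hlm => q.prec _ _ (mul_lt_mul_of_pos_left hlm (IQ.grid n).2.1) }
  have hmono : Monotone fun n => mk (cut n) := by
    intro n n' hn l
    obtain ⟨m, hm⟩ := IQ.exists_gt l
    exact ⟨m, q.prec _ _ (mul_lt_mul' (IQ.grid_mono hn) hm l.2.1.le (IQ.grid n').2.1)⟩
  have hcut : ∀ n l, Prec ((cut n).f l) (q.f (IQ.grid n)) := fun n l =>
    q.prec _ _ (mul_lt_of_lt_one_right (IQ.grid n).2.1 l.2.2)
  have hlub : IsLUB (Set.range fun n => mk (cut n)) (mk q) := by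
    constructor
    · rintro _ ⟨n, rfl⟩ l
      exact ⟨_, hcut n l⟩
    · intro w hw
      obtain ⟨w, rfl⟩ := mk_surjective w
      intro l
      obtain ⟨n, hn⟩ := l.exists_lt_grid
      have hpos := (IQ.grid n).2.1
      obtain ⟨m, hm⟩ := hw ⟨n, rfl⟩ ⟨l.1 / (IQ.grid n).1, div_pos l.2.1 hpos,
        (div_lt_one hpos).mpr hn⟩
      refine ⟨m, ?_⟩
      have hl : (IQ.grid n).mul ⟨l.1 / (IQ.grid n).1, div_pos l.2.1 hpos,
          (div_lt_one hpos).mpr hn⟩ = l :=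
        Subtype.ext (mul_div_cancel₀ _ hpos.ne')
      simpa only [cut, hl] using hm
  obtain ⟨n, hn⟩ := h _ hmono _ hlub le_rfl
  refine ⟨IQ.grid n, fun l => ?_⟩
  obtain ⟨m, hm⟩ := hn l
  exact hm.trans (hcut n m)

/-- A class dominated by a single member of the path `q` is way-below `[q]`. -/
theorem wayBelow_of_forall_prec {p q : CuPath S T} {m : IQ} (h : ∀ l, Prec (p.f l) (q.f m)) :
    WayBelow (mk p) (mk q) := by
  intro c hc s hs hqs
  obtain ⟨s, rfl⟩ := mk_surjective s
  choose r hr using fun n => mk_surjective (c n)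
  obtain rfl : (fun n => mk (r n)) = c := funext hr
  obtain ⟨k, hk⟩ := hqs m
  obtain ⟨n, j, hj⟩ := exists_prec_of_isLUB hc hs k
  exact ⟨n, fun l => ⟨j, (h l).trans (hk.trans hj)⟩⟩

end BivCu

end Sup

namespace BivCu

variable {S T P : Type*} [AddCommMonoid S] [PartialOrder S] [AddCommMonoid T] [PartialOrder T]
  [AddCommMonoid P] [PartialOrder P] [CuSemigroup S] [CuSemigroup T]

theorem comp_le_comp {y y' : BivCu T P} {x x' : BivCu S T} (hy : y ≤ y') (hx : x ≤ x') :
    comp y x ≤ comp y' x' := by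
  obtain ⟨y, rfl⟩ := mk_surjective y
  obtain ⟨y', rfl⟩ := mk_surjective y'
  obtain ⟨x, rfl⟩ := mk_surjective x
  obtain ⟨x', rfl⟩ := mk_surjective x'
  exact PathLE.comp hy hx

theorem isLUB_comp {c : ℕ → BivCu T P} {d : ℕ → BivCu S T} {s : BivCu T P} {t : BivCu S T}
    (hc : Monotone c) (hd : Monotone d) (hs : IsLUB (Set.range c) s)
    (ht : IsLUB (Set.range d) t) :
    IsLUB (Set.range fun n => comp (c n) (d n)) (comp s t) := by
  constructor
  · rintro _ ⟨n, rfl⟩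
    exact comp_le_comp (hs.1 ⟨n, rfl⟩) (ht.1 ⟨n, rfl⟩)
  · intro w hw
    obtain ⟨w, rfl⟩ := mk_surjective w
    obtain ⟨s, rfl⟩ := mk_surjective s
    obtain ⟨t, rfl⟩ := mk_surjective t
    choose p hp using fun n => mk_surjective (c n)
    obtain rfl : (fun n => mk (p n)) = c := funext hp
    choose q hq using fun n => mk_surjective (d n)
    obtain rfl : (fun n => mk (q n)) = d := funext hq
    intro l
    obtain ⟨n₁, m₁, h₁⟩ := exists_prec_of_isLUB hc hs l
    obtain ⟨n₂, m₂, h₂⟩ := exists_prec_of_isLUB hd ht l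
    obtain ⟨k₁, hk₁⟩ := hc (le_max_left n₁ n₂) m₁
    obtain ⟨k₂, hk₂⟩ := hd (le_max_right n₁ n₂) m₂
    obtain ⟨r, hr₁, hr₂⟩ := IQ.exists_gt₂ k₁ k₂
    obtain ⟨m, hm⟩ := hw ⟨max n₁ n₂, rfl⟩ r
    exact ⟨m, (Prec.comp ((h₂.trans hk₂).trans ((q _).prec _ _ hr₂))
      ((h₁.trans hk₁).trans ((p _).prec _ _ hr₁))).trans hm⟩

theorem wayBelow_comp {y y' : BivCu T P} {x x' : BivCu S T} (hy : WayBelow y' y)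
    (hx : WayBelow x' x) : WayBelow (comp y' x') (comp y x) := by
  obtain ⟨y, rfl⟩ := mk_surjective y
  obtain ⟨y', rfl⟩ := mk_surjective y'
  obtain ⟨x, rfl⟩ := mk_surjective x
  obtain ⟨x', rfl⟩ := mk_surjective x'
  obtain ⟨m₁, h₁⟩ := exists_forall_prec_of_wayBelow hy
  obtain ⟨m₂, h₂⟩ := exists_forall_prec_of_wayBelow hx
  obtain ⟨r, hr₁, hr₂⟩ := IQ.exists_gt₂ m₁ m₂
  exact wayBelow_of_forall_prec (p := y'.comp x') (q := y.comp x) (m := r) fun l =>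
    Prec.comp ((h₂ l).trans (x.prec _ _ hr₂)) ((h₁ l).trans (y.prec _ _ hr₁))

theorem comp_assoc {Q : Type*} [AddCommMonoid Q] [PartialOrder Q] [CuSemigroup P]
    (z : BivCu P Q) (y : BivCu T P) (x : BivCu S T) :
    comp (comp z y) x = comp z (comp y x) := by
  obtain ⟨z, rfl⟩ := mk_surjective z
  obtain ⟨y, rfl⟩ := mk_surjective y
  obtain ⟨x, rfl⟩ := mk_surjective x
  rfl

theorem id_comp (x : BivCu S T) : comp (id T) x = x := by
  obtain ⟨x, rfl⟩ := mk_surjective x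
  rfl

/-- The composition product is a Cu-bimorphism. -/
theorem isCuBimor_comp [CuSemigroup P] :
    IsCuBimor fun (y : BivCu T P) (x : BivCu S T) => comp y x := by
  refine ⟨fun x => ?_, fun y => ?_, fun y y' x => ?_, fun y x x' => ?_,
    fun _ _ _ h => comp_le_comp h le_rfl, fun _ _ _ h => comp_le_comp le_rfl h,
    fun _ _ _ _ hc hd hs ht => isLUB_comp hc hd hs ht, fun _ _ _ _ hy hx => wayBelow_comp hy hx⟩
  · obtain ⟨x, rfl⟩ := mk_surjective x
    rfl
  · obtain ⟨y, rfl⟩ := mk_surjective y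
    exact congrArg mk (CuPath.ext' (funext fun l => GenCuMor.ext' (funext fun _ =>
      (y.f l).map_zero')))
  · obtain ⟨y, rfl⟩ := mk_surjective y
    obtain ⟨y', rfl⟩ := mk_surjective y'
    obtain ⟨x, rfl⟩ := mk_surjective x
    rfl
  · obtain ⟨y, rfl⟩ := mk_surjective y
    obtain ⟨x, rfl⟩ := mk_surjective x
    obtain ⟨x', rfl⟩ := mk_surjective x'
    exact congrArg mk (CuPath.ext' (funext fun l => GenCuMor.ext' (funext fun _ =>
      (y.f l).map_add' _ _)))

end BivCu

/-- The composition product makes `⟦S,T⟧` a left Cu-semimodule over the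
Cu-semiring `⟦T,T⟧` and a right Cu-semimodule over `⟦S,S⟧`, and these actions are
compatible, so `⟦S,T⟧` is a `(⟦T,T⟧, ⟦S,S⟧)`-Cu-semibimodule. -/
theorem bivariant_semibimodule
    (S T : Type*) [AddCommMonoid S] [PartialOrder S] [AddCommMonoid T] [PartialOrder T]
    [CuSemigroup S] [CuSemigroup T] :
    IsCuBimor (fun (y : BivCu T T) (x : BivCu S T) => BivCu.comp y x) ∧
    (∀ (y y' : BivCu T T) (x : BivCu S T),
      BivCu.comp (BivCu.comp y y') x = BivCu.comp y (BivCu.comp y' x)) ∧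
    (∀ x : BivCu S T, BivCu.comp (BivCu.id T) x = x) ∧
    IsCuBimor (fun (x : BivCu S T) (z : BivCu S S) => BivCu.comp x z) ∧
    (∀ (x : BivCu S T) (z z' : BivCu S S),
      BivCu.comp x (BivCu.comp z z') = BivCu.comp (BivCu.comp x z) z') ∧
    (∀ x : BivCu S T, BivCu.comp x (BivCu.id S) = x) ∧
    (∀ (y : BivCu T T) (x : BivCu S T) (z : BivCu S S),
      BivCu.comp y (BivCu.comp x z) = BivCu.comp (BivCu.comp y x) z) := by
  exact ⟨BivCu.isCuBimor_comp, BivCu.comp_assoc, BivCu.id_comp, BivCu.isCuBimor_comp,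
    fun x z z' => (BivCu.comp_assoc x z z').symm, BivCu.comp_id,
    fun y x z => (BivCu.comp_assoc y x z).symm⟩
end
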